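/- Let σ ∈ S_m and let q > 0 be a real number. Then the ratio (Σ_{π ∈ I_n(σ)} q^{maj(π^{>m})}) / (Σ_{π ∈ I_n} q^{maj(π^{>m})}) converges as n → ∞ to [ Σ_{j ∈ J(σ)} q^{maj(σ^{>j})} · [m choose j]_q · [j]_q! · (1-q̄)^j ] / [ Σ_{j=0}^{m} [m]_q! · t_j · C(m,j) · (1-q̄)^j ], where q̄ = min(q, q^{-1}) and t_j is the number of involutions in S_j. -/

import Mathlib

open Finset

namespace QT

/-- The major index of a permutation of `Fin n` (sum of descents,
with positions written `1,...,n-1` as in one-line notation). -/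
def maj {n : ℕ} (π : Equiv.Perm (Fin n)) : ℕ :=
  ∑ i ∈ Finset.range n,
    if h : i + 1 < n then
      (if π ⟨i + 1, h⟩ < π ⟨i, by omega⟩ then i + 1 else 0)
    else 0

/-- `imaj π = maj π⁻¹`. -/
def imaj {n : ℕ} (π : Equiv.Perm (Fin n)) : ℕ := maj π⁻¹

/-- The permutation of `Fin k` order-isomorphic to the word `v 0, v 1, ..., v (k-1)`. -/
noncomputable def standardize {n k : ℕ} (v : Fin k → Fin n) (hv : Function.Injective v) :
    Equiv.Perm (Fin k) :=
  Equiv.ofBijective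
    (fun i => (Finset.orderIsoOfFin (Finset.image v Finset.univ)
        (by rw [Finset.card_image_of_injective _ hv, Finset.card_univ, Fintype.card_fin])).symm
        ⟨v i, Finset.mem_image_of_mem v (Finset.mem_univ i)⟩)
    (Finite.injective_iff_bijective.mp (fun i j hij => by
      have h2 := (Finset.orderIsoOfFin _ _).symm.injective hij
      exact hv (congrArg Subtype.val h2)))

/-- `π^{≤k}` : the permutation of `Fin k` order-isomorphic to the first `k` letters of `π`. -/
noncomputable def pInit {n : ℕ} (π : Equiv.Perm (Fin n)) (k : ℕ) (hk : k ≤ n) :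
    Equiv.Perm (Fin k) :=
  standardize (fun i => π (Fin.castLE hk i))
    (fun i j h => Fin.castLE_injective hk (π.injective h))

/-- `π^{>k}` : the permutation of `Fin (n-k)` order-isomorphic to the last `n - k` letters of `π`. -/
noncomputable def pTail {n : ℕ} (π : Equiv.Perm (Fin n)) (k : ℕ) :
    Equiv.Perm (Fin (n - k)) :=
  standardize (fun i => π ⟨k + (i : ℕ), by have := i.isLt; omega⟩)
    (fun i j h => by
      have h2 : k + (i : ℕ) = k + (j : ℕ) := congrArg Fin.val (π.injective h)
      exact Fin.ext (by omega))

/-- `π_{≤k}` : the permutation of `Fin k` order-isomorphic to the subword of `π`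
consisting of the `k` smallest values.  (Equivalently `((π⁻¹)^{≤k})⁻¹`.) -/
noncomputable def vLow {n : ℕ} (π : Equiv.Perm (Fin n)) (k : ℕ) (hk : k ≤ n) :
    Equiv.Perm (Fin k) := (pInit π⁻¹ k hk)⁻¹

/-- `π_{>k}` : the permutation of `Fin (n-k)` order-isomorphic to the subword of `π`
consisting of the values `> k`.  (Equivalently `((π⁻¹)^{>k})⁻¹`.) -/
noncomputable def vHigh {n : ℕ} (π : Equiv.Perm (Fin n)) (k : ℕ) :
    Equiv.Perm (Fin (n - k)) := (pTail π⁻¹ k)⁻¹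

/-- The set `I_n` of involutions in `S_n`. -/
def involutions (n : ℕ) : Finset (Equiv.Perm (Fin n)) :=
  Finset.univ.filter fun π => π * π = 1

-- `I_n(σ) = {π ∈ I_n : π_{≤m} = σ}`.
open scoped Classical in
noncomputable def involutionsC (n : ℕ) {m : ℕ} (σ : Equiv.Perm (Fin m)) :
    Finset (Equiv.Perm (Fin n)) :=
  (involutions n).filter fun π => ∃ h : m ≤ n, vLow π m h = σ

-- `S_n(σ,τ) = {π ∈ S_n : π_{≤a} = σ, π^{≤b} = τ}`.
open scoped Classical in
noncomputable def permsC (n : ℕ) {a b : ℕ} (σ : Equiv.Perm (Fin a)) (τ : Equiv.Perm (Fin b)) :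
    Finset (Equiv.Perm (Fin n)) :=
  Finset.univ.filter fun π => ∃ (ha : a ≤ n) (hb : b ≤ n), vLow π a ha = σ ∧ pInit π b hb = τ

-- The j-set `J(σ) = {j : σ^{≤j} is an involution}`.
open scoped Classical in
noncomputable def jSet {m : ℕ} (σ : Equiv.Perm (Fin m)) : Finset ℕ :=
  (Finset.range (m + 1)).filter fun j => ∃ h : j ≤ m, pInit σ j h * pInit σ j h = 1

-- The j₂-set `J(σ,τ) = {j : σ^{≤j} = τ_{≤j}}`.
open scoped Classical in
noncomputable def j2Set {a b : ℕ} (σ : Equiv.Perm (Fin a)) (τ : Equiv.Perm (Fin b)) :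
    Finset ℕ :=
  (Finset.range (min a b + 1)).filter fun j =>
    ∃ (ha : j ≤ a) (hb : j ≤ b), pInit σ j ha = vLow τ j hb

/-- A set of nonnegative integers is a j₂-set if it is `J(σ,τ)` for some pair of
permutations. -/
def IsJ2Set (S : Finset ℕ) : Prop :=
  ∃ (a b : ℕ) (σ : Equiv.Perm (Fin a)) (τ : Equiv.Perm (Fin b)), S = j2Set σ τ

-- The number of j₂-sets with largest element `n`.
open scoped Classical in
noncomputable def j2count (n : ℕ) : ℕ :=
  ((Finset.range (n + 1)).powerset.filter
    fun S => IsJ2Set S ∧ n ∈ S ∧ ∀ x ∈ S, x ≤ n).card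

/-- `[n]_q = 1 + q + ⋯ + q^{n-1}`. -/
def qInt (q : ℝ) (n : ℕ) : ℝ := ∑ i ∈ Finset.range n, q ^ i

/-- The q-factorial `[n]_q! = ∏_{i=1}^n (1 + q + ⋯ + q^{i-1})`. -/
def qFact (q : ℝ) (n : ℕ) : ℝ := ∏ i ∈ Finset.range n, qInt q (i + 1)

/-- The Gaussian binomial coefficient `[n choose k]_q = [n]_q!/([k]_q! [n-k]_q!)`,
defined via the q-Pascal recursion. -/
def qBinom (q : ℝ) : ℕ → ℕ → ℝ
  | _, 0 => 1
  | 0, _ + 1 => 0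
  | n + 1, k + 1 => qBinom q n k + q ^ (k + 1) * qBinom q n (k + 1)

/-- `t_n(q) = Σ_{π ∈ I_n} q^{maj π}`. -/
noncomputable def tq (q : ℝ) (n : ℕ) : ℝ := ∑ π ∈ involutions n, q ^ maj π

/-- `A_n(p,q) = Σ_{π ∈ S_n} p^{imaj π} q^{maj π}`. -/
noncomputable def Apq (p q : ℝ) (n : ℕ) : ℝ :=
  ∑ π : Equiv.Perm (Fin n), p ^ imaj π * q ^ maj π

section qNumbers

variable {q : ℝ}

theorem qInt_add (q : ℝ) (a b : ℕ) : qInt q (a + b) = qInt q a + q ^ a * qInt q b := by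
  simp only [qInt, Finset.sum_range_add, pow_add, Finset.mul_sum]

theorem qInt_succ_pos (hq : 0 < q) (n : ℕ) : 0 < qInt q (n + 1) :=
  Finset.sum_pos (fun i _ => pow_pos hq i) ⟨0, by simp⟩

theorem qFact_succ (q : ℝ) (n : ℕ) : qFact q (n + 1) = qFact q n * qInt q (n + 1) :=
  Finset.prod_range_succ _ _

theorem qFact_zero (q : ℝ) : qFact q 0 = 1 := Finset.prod_range_zero _

theorem qFact_pos (hq : 0 < q) (n : ℕ) : 0 < qFact q n :=
  Finset.prod_pos fun i _ => qInt_succ_pos hq i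

/-- The symmetric form `[a+b]_q! / ([a]_q! [b]_q!)` of the Gaussian binomial coefficient. -/
noncomputable def qMulti (q : ℝ) (a b : ℕ) : ℝ := qFact q (a + b) / (qFact q a * qFact q b)

theorem qMulti_zero_left (hq : 0 < q) (b : ℕ) : qMulti q 0 b = 1 := by
  have := (qFact_pos hq b).ne'
  simp [qMulti, qFact_zero, this]

theorem qMulti_zero_right (hq : 0 < q) (a : ℕ) : qMulti q a 0 = 1 := by
  have := (qFact_pos hq a).ne'
  simp [qMulti, qFact_zero, this]

theorem qMulti_pascal (hq : 0 < q) (a b : ℕ) :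
    qMulti q (a + 1) (b + 1) = qMulti q a (b + 1) + q ^ (a + 1) * qMulti q (a + 1) b := by
  have ha := (qFact_pos hq a).ne'
  have hb := (qFact_pos hq b).ne'
  have ha' := (qInt_succ_pos hq a).ne'
  have hb' := (qInt_succ_pos hq b).ne'
  have e1 : a + 1 + (b + 1) = (a + b + 1) + 1 := by ring
  have e2 : a + (b + 1) = a + b + 1 := by ring
  have e3 : a + 1 + b = a + b + 1 := by ring
  have h : qInt q (a + b + 1 + 1) = qInt q (a + 1) + q ^ (a + 1) * qInt q (b + 1) := by
    rw [← qInt_add, e1]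
  simp only [qMulti, e1, e2, e3, qFact_succ, h]
  field_simp

theorem qMulti_pascal' (hq : 0 < q) (a b : ℕ) :
    qMulti q (a + 1) (b + 1) = q ^ (b + 1) * qMulti q a (b + 1) + qMulti q (a + 1) b := by
  have ha := (qFact_pos hq a).ne'
  have hb := (qFact_pos hq b).ne'
  have ha' := (qInt_succ_pos hq a).ne'
  have hb' := (qInt_succ_pos hq b).ne'
  have e1 : a + 1 + (b + 1) = (a + b + 1) + 1 := by ring
  have e2 : a + (b + 1) = a + b + 1 := by ring
  have e3 : a + 1 + b = a + b + 1 := by ring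
  have h : qInt q (a + b + 1 + 1) = qInt q (b + 1) + q ^ (b + 1) * qInt q (a + 1) := by
    rw [← qInt_add]; congr 1; ring
  simp only [qMulti, e1, e2, e3, qFact_succ, h]
  field_simp
  ring

theorem qBinom_eq_zero (q : ℝ) {n k : ℕ} (h : n < k) : qBinom q n k = 0 := by
  induction n generalizing k with
  | zero => obtain ⟨k, rfl⟩ := Nat.exists_eq_succ_of_ne_zero h.ne'; simp [qBinom]
  | succ n ih =>
    obtain ⟨k, rfl⟩ := Nat.exists_eq_succ_of_ne_zero (Nat.ne_zero_of_lt h)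
    simp [qBinom, ih (show n < k by omega), ih (show n < k + 1 by omega)]

theorem qBinom_add (hq : 0 < q) (a b : ℕ) : qBinom q (a + b) a = qMulti q a b := by
  induction a generalizing b with
  | zero => simp [qBinom, qMulti_zero_left hq]
  | succ a iha =>
    induction b with
    | zero =>
      have h := iha 0
      simp only [add_zero] at h
      simp [qBinom, qBinom_eq_zero, qMulti_zero_right hq, h]
    | succ b ihb =>
      rw [qMulti_pascal hq, ← ihb, ← iha, show a + 1 + (b + 1) = (a + 1 + b) + 1 by ring,
        show a + (b + 1) = a + 1 + b by ring]
      exact qBinom.eq_3 q (a + 1 + b) a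

end qNumbers

section shuffles

/-- The major index of the word `w 0, ..., w (N - 1)`. -/
def wmaj (w : ℕ → ℕ) (N : ℕ) : ℕ := ∑ i ∈ Finset.range N, if w i < w (i - 1) then i else 0

theorem wmaj_succ (w : ℕ → ℕ) (N : ℕ) :
    wmaj w (N + 1) = wmaj w N + if w N < w (N - 1) then N else 0 :=
  Finset.sum_range_succ _ _

theorem wmaj_zero (w : ℕ → ℕ) : wmaj w 0 = 0 := Finset.sum_range_zero _

theorem wmaj_congr {w w' : ℕ → ℕ} {N : ℕ}
    (h : ∀ i < N, ∀ j < N, w i < w j ↔ w' i < w' j) : wmaj w N = wmaj w' N := by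
  refine Finset.sum_congr rfl fun i hi => ?_
  have hi := Finset.mem_range.1 hi
  simp only [h i hi (i - 1) (by omega)]

/-- The shuffle of the words `u` and `v` whose letters from `u` sit at the positions in `B`. -/
def shuffle (u v : ℕ → ℕ) (B : Finset ℕ) (i : ℕ) : ℕ :=
  if i ∈ B then u (Nat.count (· ∈ B) i) else v (Nat.count (· ∉ B) i)

variable {u v : ℕ → ℕ}

theorem shuffle_insert_of_lt {B : Finset ℕ} {N i : ℕ} (hi : i < N) :
    shuffle u v (insert N B) i = shuffle u v B i := by
  have h : ∀ k < i, (k ∈ insert N B ↔ k ∈ B) := fun k hk => by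
    rw [Finset.mem_insert]; exact or_iff_right (by omega)
  have h1 : Nat.count (· ∈ insert N B) i = Nat.count (· ∈ B) i := by
    simp only [Nat.count_eq_card_filter_range]
    exact congrArg Finset.card (Finset.filter_congr fun k hk => h k (Finset.mem_range.1 hk))
  have h2 : Nat.count (· ∉ insert N B) i = Nat.count (· ∉ B) i := by
    simp only [Nat.count_eq_card_filter_range]
    exact congrArg Finset.card
      (Finset.filter_congr fun k hk => not_congr (h k (Finset.mem_range.1 hk)))
  have h3 : (i ∈ insert N B ↔ i ∈ B) := by
    rw [Finset.mem_insert]; exact or_iff_right (by omega)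
  simp only [shuffle, h1, h2, h3]

theorem wmaj_shuffle_insert (B : Finset ℕ) (N : ℕ) :
    wmaj (shuffle u v (insert N B)) N = wmaj (shuffle u v B) N := by
  refine wmaj_congr fun i hi j hj => ?_
  rw [shuffle_insert_of_lt hi, shuffle_insert_of_lt hj]

theorem count_mem {a N : ℕ} {B : Finset ℕ} (hB : B ∈ Finset.powersetCard a (Finset.range N)) :
    Nat.count (· ∈ B) N = a := by
  rw [Finset.mem_powersetCard] at hB
  rw [Nat.count_eq_card_filter_range, Finset.filter_mem_eq_inter,
    Finset.inter_eq_right.2 hB.1, hB.2]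

theorem count_notMem {a b : ℕ} {B : Finset ℕ}
    (hB : B ∈ Finset.powersetCard a (Finset.range (a + b))) :
    Nat.count (· ∉ B) (a + b) = b := by
  have h := count_mem hB
  have h' := Finset.card_filter_add_card_filter_not (s := Finset.range (a + b)) (· ∈ B)
  rw [Nat.count_eq_card_filter_range] at h ⊢
  rw [Finset.card_range] at h'
  omega

theorem shuffle_top_notMem {a b : ℕ} {B : Finset ℕ}
    (hB : B ∈ Finset.powersetCard a (Finset.range (a + b))) :
    shuffle u v B (a + b) = v b := by
  have h : a + b ∉ B := fun h => by
    simpa using (Finset.mem_powersetCard.1 hB).1 h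
  rw [shuffle, if_neg h, count_notMem hB]

theorem shuffle_top_insert {a b : ℕ} {B : Finset ℕ}
    (hB : B ∈ Finset.powersetCard a (Finset.range (a + b))) :
    shuffle u v (insert (a + b) B) (a + b) = u a := by
  rw [shuffle, if_pos (Finset.mem_insert_self _ _)]
  have : Nat.count (· ∈ insert (a + b) B) (a + b) = Nat.count (· ∈ B) (a + b) := by
    simp only [Nat.count_eq_card_filter_range]
    refine congrArg Finset.card (Finset.filter_congr fun k hk => ?_)
    have := Finset.mem_range.1 hk
    rw [Finset.mem_insert]; exact or_iff_right (by omega)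
  rw [this, count_mem hB]

/-- The subsets of an initial segment split according to whether they contain the top element. -/
theorem sum_powersetCard_range_succ (f : Finset ℕ → ℝ) (a N : ℕ) :
    ∑ B ∈ Finset.powersetCard (a + 1) (Finset.range (N + 1)), f B =
      ∑ B ∈ Finset.powersetCard a (Finset.range N), f (insert N B) +
        ∑ B ∈ Finset.powersetCard (a + 1) (Finset.range N), f B := by
  have hN : N ∉ Finset.range N := by simp
  have hmem : ∀ {k : ℕ} {B : Finset ℕ}, B ∈ Finset.powersetCard k (Finset.range N) → N ∉ B :=
    fun hB h => hN ((Finset.mem_powersetCard.1 hB).1 h)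
  rw [Finset.range_add_one, Finset.powersetCard_succ_insert hN, Finset.sum_union, add_comm,
    Finset.sum_image]
  · intro B hB B' hB' h
    rw [← Finset.erase_insert (hmem hB), ← Finset.erase_insert (hmem hB'), h]
  · rw [Finset.disjoint_left]
    intro B hB hB'
    obtain ⟨B', -, rfl⟩ := Finset.mem_image.1 hB'
    exact hmem hB (Finset.mem_insert_self _ _)

/-- The shuffles of two words, split by the word that supplies the last letter. -/
theorem sum_shuffle_succ_succ (a b : ℕ) (f : Finset ℕ → ℝ) :
    ∑ B ∈ Finset.powersetCard (a + 1) (Finset.range (a + 1 + (b + 1))), f B =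
      ∑ B ∈ Finset.powersetCard a (Finset.range (a + (b + 1))), f (insert (a + (b + 1)) B) +
        ∑ B ∈ Finset.powersetCard (a + 1) (Finset.range (a + 1 + b)), f B := by
  rw [show a + 1 + (b + 1) = (a + (b + 1)) + 1 by ring, sum_powersetCard_range_succ,
    show a + (b + 1) = a + 1 + b by ring]

theorem powersetCard_range_self (a : ℕ) :
    Finset.powersetCard a (Finset.range (a + 0)) = {Finset.range a} := by
  simpa using Finset.powersetCard_self (Finset.range a)

theorem wmaj_shuffle_range (a : ℕ) : wmaj (shuffle u v (Finset.range a)) a = wmaj u a := by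
  have h : ∀ i < a, shuffle u v (Finset.range a) i = u i := fun i hi => by
    rw [shuffle, if_pos (Finset.mem_range.2 hi)]
    congr 1
    rw [Nat.count_eq_card_filter_range, Finset.filter_true_of_mem, Finset.card_range]
    intro k hk
    rw [Finset.mem_range] at *
    omega
  exact wmaj_congr fun i hi j hj => by rw [h i hi, h j hj]

theorem wmaj_shuffle_empty (b : ℕ) : wmaj (shuffle u v ∅) b = wmaj v b := by
  have h : ∀ i, shuffle u v ∅ i = v i := fun i => by
    rw [shuffle, if_neg (by simp)]
    congr 1
    simp
  exact wmaj_congr fun i hi j hj => by rw [h i, h j]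

theorem sum_shuffle_ends {q : ℝ} (hq : 0 < q) (huv : ∀ i j, u i < v j) (N : ℕ) :
    ∀ a b, a + b = N →
      ∑ B ∈ Finset.powersetCard a (Finset.range (a + b)),
          q ^ wmaj (shuffle u v B) (a + b + 1) =
        q ^ (wmaj u a + wmaj v (b + 1)) * qMulti q a b ∧
      ∑ B ∈ Finset.powersetCard a (Finset.range (a + b)),
          q ^ wmaj (shuffle u v (insert (a + b) B)) (a + b + 1) =
        q ^ (wmaj u (a + 1) + wmaj v b + b) * qMulti q a b := by
  induction N with
  | zero =>
    intro a b hab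
    obtain ⟨rfl, rfl⟩ : a = 0 ∧ b = 0 := by omega
    simp [wmaj, qMulti_zero_left hq]
  | succ N ih =>
    intro a b hab
    rcases a with - | a
    · obtain ⟨b, rfl⟩ : ∃ c, b = c + 1 := ⟨b - 1, by omega⟩
      have h0 : (∅ : Finset ℕ) ∈ Finset.powersetCard 0 (Finset.range (0 + (b + 1))) := by simp
      have h1 : (∅ : Finset ℕ) ∈ Finset.powersetCard 0 (Finset.range (0 + b)) := by simp
      have h2 := shuffle_top_insert (u := u) (v := v) h0
      have h3 := shuffle_insert_of_lt (u := u) (v := v) (B := ∅) (show 0 + b < 0 + (b + 1) by omega)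
      have h4 := shuffle_top_notMem (u := u) (v := v) h1
      refine ⟨?_, ?_⟩
      · simp [wmaj_shuffle_empty, qMulti_zero_left hq, wmaj_zero]
      · rw [Finset.powersetCard_zero, Finset.sum_singleton, wmaj_succ _ (0 + (b + 1)), h2,
          show 0 + (b + 1) - 1 = 0 + b by omega, h3, h4, if_pos (huv _ _), wmaj_shuffle_insert,
          wmaj_shuffle_empty, qMulti_zero_left hq]
        simp [wmaj]
    rcases b with - | b
    · have h : insert (a + 1) (Finset.range (a + 1)) = Finset.range (a + 1 + 1) :=
        Finset.range_add_one.symm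
      rw [powersetCard_range_self, Finset.sum_singleton, Finset.sum_singleton, add_zero, h,
        wmaj_shuffle_range, wmaj_succ, wmaj_shuffle_range, qMulti_zero_right hq]
      have h0 : Finset.range (a + 1) ∈
          Finset.powersetCard (a + 1) (Finset.range (a + 1 + 0)) := by
        rw [powersetCard_range_self]; simp
      have h1 : Finset.range a ∈ Finset.powersetCard a (Finset.range (a + 0)) := by
        rw [powersetCard_range_self]; simp
      have h2 := shuffle_top_notMem (u := u) (v := v) h0
      have h3 := shuffle_top_insert (u := u) (v := v) h1
      simp only [add_zero, ← Finset.range_add_one] at h2 h3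
      rw [h2, show a + 1 - 1 = a by omega, h3, if_neg (huv _ _).not_gt]
      simp [wmaj]
    obtain ⟨hV, -⟩ := ih (a + 1) b (by omega)
    obtain ⟨-, hU⟩ := ih a (b + 1) (by omega)
    have eT : a + 1 + (b + 1) = a + (b + 1) + 1 := by ring
    have eT' : a + 1 + (b + 1) = a + 1 + b + 1 := by ring
    rw [sum_shuffle_succ_succ, sum_shuffle_succ_succ]
    constructor
    · have e1 : ∀ B ∈ Finset.powersetCard a (Finset.range (a + (b + 1))),
          q ^ wmaj (shuffle u v (insert (a + (b + 1)) B)) (a + 1 + (b + 1) + 1) =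
            q ^ wmaj (shuffle u v (insert (a + (b + 1)) B)) (a + (b + 1) + 1) := by
        intro B hB
        have hB' : insert (a + (b + 1)) B ∈
            Finset.powersetCard (a + 1) (Finset.range (a + 1 + (b + 1))) := by
          rw [eT, Finset.range_add_one, Finset.powersetCard_succ_insert (by simp)]
          exact Finset.mem_union_right _ (Finset.mem_image_of_mem _ hB)
        rw [wmaj_succ, shuffle_top_notMem hB', show a + 1 + (b + 1) - 1 = a + (b + 1) by omega,
          shuffle_top_insert hB, if_neg (huv _ _).not_gt, add_zero, eT]
      have e2 : ∀ B ∈ Finset.powersetCard (a + 1) (Finset.range (a + 1 + b)),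
          q ^ wmaj (shuffle u v B) (a + 1 + (b + 1) + 1) =
            q ^ wmaj (shuffle u v B) (a + 1 + b + 1) *
              q ^ (if v (b + 1) < v b then a + 1 + (b + 1) else 0) := by
        intro B hB
        have hB' : B ∈ Finset.powersetCard (a + 1) (Finset.range (a + 1 + (b + 1))) :=
          Finset.powersetCard_mono (Finset.range_mono (by omega)) hB
        rw [wmaj_succ, shuffle_top_notMem hB', show a + 1 + (b + 1) - 1 = a + 1 + b by omega,
          shuffle_top_notMem hB, ← pow_add, ← eT']
      rw [Finset.sum_congr rfl e1, Finset.sum_congr rfl e2, ← Finset.sum_mul, hU, hV,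
        wmaj_succ v (b + 1), show b + 1 - 1 = b by omega]
      split_ifs
      · rw [qMulti_pascal hq]; ring
      · rw [qMulti_pascal' hq]; ring
    · have e1 : ∀ B ∈ Finset.powersetCard a (Finset.range (a + (b + 1))),
          q ^ wmaj (shuffle u v (insert (a + 1 + (b + 1)) (insert (a + (b + 1)) B)))
              (a + 1 + (b + 1) + 1) =
            q ^ wmaj (shuffle u v (insert (a + (b + 1)) B)) (a + (b + 1) + 1) *
              q ^ (if u (a + 1) < u a then a + 1 + (b + 1) else 0) := by
        intro B hB
        have hB' : insert (a + (b + 1)) B ∈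
            Finset.powersetCard (a + 1) (Finset.range (a + 1 + (b + 1))) := by
          rw [eT, Finset.range_add_one, Finset.powersetCard_succ_insert (by simp)]
          exact Finset.mem_union_right _ (Finset.mem_image_of_mem _ hB)
        rw [wmaj_succ, wmaj_shuffle_insert, shuffle_top_insert hB',
          show a + 1 + (b + 1) - 1 = a + (b + 1) by omega, shuffle_insert_of_lt (by omega),
          shuffle_top_insert hB, ← pow_add, ← eT]
      have e2 : ∀ B ∈ Finset.powersetCard (a + 1) (Finset.range (a + 1 + b)),
          q ^ wmaj (shuffle u v (insert (a + 1 + (b + 1)) B)) (a + 1 + (b + 1) + 1) =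
            q ^ wmaj (shuffle u v B) (a + 1 + b + 1) * q ^ (a + 1 + (b + 1)) := by
        intro B hB
        have hB' : B ∈ Finset.powersetCard (a + 1) (Finset.range (a + 1 + (b + 1))) :=
          Finset.powersetCard_mono (Finset.range_mono (by omega)) hB
        rw [wmaj_succ, wmaj_shuffle_insert, shuffle_top_insert hB',
          show a + 1 + (b + 1) - 1 = a + 1 + b by omega, shuffle_insert_of_lt (by omega),
          shuffle_top_notMem hB, if_pos (huv _ _), ← pow_add, ← eT']
      rw [Finset.sum_congr rfl e1, Finset.sum_congr rfl e2, ← Finset.sum_mul, ← Finset.sum_mul,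
        hU, hV, wmaj_succ u (a + 1), show a + 1 - 1 = a by omega]
      split_ifs
      · rw [qMulti_pascal' hq]; ring
      · rw [qMulti_pascal hq]; ring

/-- The major index of the shuffles of two words `u` and `v` with all letters of `u` below those
of `v` is distributed as `q ^ (maj u + maj v)` times a Gaussian binomial coefficient. -/
theorem sum_shuffle {q : ℝ} (hq : 0 < q) (huv : ∀ i j, u i < v j) (a b : ℕ) :
    ∑ B ∈ Finset.powersetCard a (Finset.range (a + b)), q ^ wmaj (shuffle u v B) (a + b) =
      q ^ (wmaj u a + wmaj v b) * qMulti q a b := by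
  rcases a with - | a
  · simp [wmaj_shuffle_empty, qMulti_zero_left hq, wmaj_zero]
  rcases b with - | b
  · rw [powersetCard_range_self, Finset.sum_singleton, add_zero, wmaj_shuffle_range,
      qMulti_zero_right hq]
    simp [wmaj]
  rw [sum_shuffle_succ_succ, show a + 1 + (b + 1) = a + (b + 1) + 1 by ring,
    (sum_shuffle_ends hq huv _ _ _ rfl).2, show a + (b + 1) + 1 = a + 1 + b + 1 by ring,
    (sum_shuffle_ends hq huv _ _ _ rfl).1, qMulti_pascal' hq]
  ring

end shuffles

section words

/-- The one-line notation of a permutation of `Fin n`, extended by the identity. -/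
def val {n : ℕ} (π : Equiv.Perm (Fin n)) (i : ℕ) : ℕ := if h : i < n then π ⟨i, h⟩ else i

theorem val_of_lt {n i : ℕ} (π : Equiv.Perm (Fin n)) (h : i < n) : val π i = π ⟨i, h⟩ :=
  dif_pos h

theorem maj_eq_wmaj {n : ℕ} (π : Equiv.Perm (Fin n)) : maj π = wmaj (val π) n := by
  rcases n with - | n
  · simp [maj, wmaj_zero]
  rw [maj, wmaj, Finset.sum_range_succ, Finset.sum_range_succ', dif_neg (lt_irrefl _)]
  simp only [add_tsub_cancel_right, ite_self, add_zero]
  refine Finset.sum_congr rfl fun i hi => ?_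
  have hi := Finset.mem_range.1 hi
  rw [dif_pos (by omega), val_of_lt π (show i + 1 < n + 1 by omega),
    val_of_lt π (show i < n + 1 by omega)]
  rfl

theorem standardize_lt_standardize {n k : ℕ} (v : Fin k → Fin n) (hv : Function.Injective v)
    (i j : Fin k) : standardize v hv i < standardize v hv j ↔ v i < v j := by
  simp only [standardize, Equiv.ofBijective_apply, OrderIso.lt_iff_lt, Subtype.mk_lt_mk]

theorem maj_standardize {n k : ℕ} (v : Fin k → Fin n) (hv : Function.Injective v) (w : ℕ → ℕ)
    (hw : ∀ i : Fin k, w i = v i) : maj (standardize v hv) = wmaj w k := by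
  rw [maj_eq_wmaj]
  refine wmaj_congr fun i hi j hj => ?_
  rw [val_of_lt _ hi, val_of_lt _ hj, hw ⟨i, hi⟩, hw ⟨j, hj⟩, ← Fin.lt_def, ← Fin.lt_def,
    standardize_lt_standardize]

theorem maj_pTail {n : ℕ} (π : Equiv.Perm (Fin n)) (m : ℕ) :
    maj (pTail π m) = wmaj (fun i => val π (m + i)) (n - m) :=
  maj_standardize _ _ _ fun _ => val_of_lt _ _

theorem perm_eq_one_of_strictMono {n : ℕ} (τ : Equiv.Perm (Fin n)) (h : StrictMono τ) :
    τ = 1 := by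
  have h' : StrictMono τ.symm := fun i j hij => by
    by_contra hc
    have := h.monotone (not_lt.1 hc)
    simp only [Equiv.apply_symm_apply] at this
    exact absurd this hij.not_ge
  ext i
  have h1 := h.le_apply (x := i)
  have h2 := h.monotone (h'.le_apply (x := i))
  rw [Equiv.apply_symm_apply] at h2
  exact congrArg Fin.val (le_antisymm h2 h1)

theorem perm_eq_of_lt_iff {n : ℕ} {s t : Equiv.Perm (Fin n)}
    (h : ∀ i j, s i < s j ↔ t i < t j) : s = t := by
  have := perm_eq_one_of_strictMono (s * t⁻¹) fun i j hij => by
    simp only [Equiv.Perm.mul_apply]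
    rw [h]
    simpa using hij
  rwa [mul_inv_eq_one] at this

theorem pInit_lt_pInit {n k : ℕ} (π : Equiv.Perm (Fin n)) (hk : k ≤ n) (i j : Fin k) :
    pInit π k hk i < pInit π k hk j ↔ π (Fin.castLE hk i) < π (Fin.castLE hk j) :=
  standardize_lt_standardize _ _ _ _

theorem eq_pInit_iff {n k : ℕ} (π : Equiv.Perm (Fin n)) (hk : k ≤ n) (s : Equiv.Perm (Fin k)) :
    s = pInit π k hk ↔
      ∀ i j, s i < s j ↔ π (Fin.castLE hk i) < π (Fin.castLE hk j) := by
  constructor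
  · rintro rfl
    exact pInit_lt_pInit π hk
  · intro h
    exact perm_eq_of_lt_iff fun i j => by rw [h, pInit_lt_pInit]

theorem inv_eq_self_of_mem {n : ℕ} {π : Equiv.Perm (Fin n)} (h : π ∈ involutions n) :
    π⁻¹ = π :=
  inv_eq_of_mul_eq_one_left (Finset.mem_filter.1 h).2

theorem mem_involutions {n : ℕ} {π : Equiv.Perm (Fin n)} :
    π ∈ involutions n ↔ ∀ i, π (π i) = i := by
  simp [involutions, Equiv.ext_iff]

/-- An involution contains `σ` as its pattern of small values iff it is increasing along `σ`. -/
theorem vLow_eq_iff {n m : ℕ} {π : Equiv.Perm (Fin n)} (hπ : π ∈ involutions n) (h : m ≤ n)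
    (σ : Equiv.Perm (Fin m)) :
    vLow π m h = σ ↔ StrictMono fun y => π (Fin.castLE h (σ y)) := by
  rw [vLow, inv_eq_self_of_mem hπ, inv_eq_iff_eq_inv, eq_comm, eq_pInit_iff]
  constructor
  · intro H y z hyz
    exact (H (σ y) (σ z)).1 (by simpa using hyz)
  · intro H i j
    obtain ⟨y, rfl⟩ := σ.surjective i
    obtain ⟨z, rfl⟩ := σ.surjective j
    simpa using H.lt_iff_lt.symm

end words

section assembly

/-- The permutation of `(Fin j ⊕ Fin k) ⊕ (Fin k ⊕ Fin M)` acting by `s` and `ρ` on the outer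
blocks and exchanging the two inner blocks. -/
def core {j k M : ℕ} (s : Equiv.Perm (Fin j)) (ρ : Equiv.Perm (Fin M)) :
    Equiv.Perm ((Fin j ⊕ Fin k) ⊕ (Fin k ⊕ Fin M)) where
  toFun x := match x with
    | .inl (.inl i) => .inl (.inl (s i))
    | .inl (.inr i) => .inr (.inl i)
    | .inr (.inl i) => .inl (.inr i)
    | .inr (.inr i) => .inr (.inr (ρ i))
  invFun x := match x with
    | .inl (.inl i) => .inl (.inl (s.symm i))
    | .inl (.inr i) => .inr (.inl i)
    | .inr (.inl i) => .inl (.inr i)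
    | .inr (.inr i) => .inr (.inr (ρ.symm i))
  left_inv x := by rcases x with (i | i) | (i | i) <;> simp
  right_inv x := by rcases x with (i | i) | (i | i) <;> simp

/-- Labels the four kinds of positions of an involution with small-value pattern `σ`: small
positions with small values, small positions with large values, and the large positions in `B`
(small values) and outside `B` (large values). -/
noncomputable def blockEquiv {j k M : ℕ} (σ : Equiv.Perm (Fin (j + k))) (s : Equiv.Perm (Fin j))
    {B : Finset (Fin (k + M))} (hB : B.card = k) (hBc : Bᶜ.card = M) :
    (Fin j ⊕ Fin k) ⊕ (Fin k ⊕ Fin M) ≃ Fin ((j + k) + (k + M)) :=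
  (Equiv.sumCongr ((Equiv.sumCongr s 1).trans (finSumFinEquiv.trans σ))
    (finSumEquivOfFinset hB hBc)).trans finSumFinEquiv

/-- The involution with small-value pattern `σ`, set `B` of large positions with small values,
and pattern `ρ` on the remaining large positions. -/
noncomputable def assemble {j k M : ℕ} (σ : Equiv.Perm (Fin (j + k))) (s : Equiv.Perm (Fin j))
    {B : Finset (Fin (k + M))} (hB : B.card = k) (hBc : Bᶜ.card = M) (ρ : Equiv.Perm (Fin M)) :
    Equiv.Perm (Fin ((j + k) + (k + M))) :=
  (blockEquiv σ s hB hBc).permCongr (core s ρ)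

/-- The large positions (relative to `m`) at which `π` takes small values. -/
def lowSet {m N : ℕ} (π : Equiv.Perm (Fin (m + N))) : Finset (Fin N) :=
  Finset.univ.filter fun p => (π (Fin.natAdd m p)).val < m

variable {j k M : ℕ} {σ : Equiv.Perm (Fin (j + k))} {s : Equiv.Perm (Fin j)}
  {B : Finset (Fin (k + M))} (hB : B.card = k) (hBc : Bᶜ.card = M) {ρ : Equiv.Perm (Fin M)}

theorem assemble_blockEquiv (x : (Fin j ⊕ Fin k) ⊕ (Fin k ⊕ Fin M)) :
    assemble σ s hB hBc ρ (blockEquiv σ s hB hBc x) = blockEquiv σ s hB hBc (core s ρ x) := by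
  simp [assemble, Equiv.permCongr_apply]

theorem blockEquiv_inl_inl (i : Fin j) :
    blockEquiv σ s hB hBc (.inl (.inl i)) =
      Fin.castAdd (k + M) (σ (Fin.castAdd k (s i))) := by
  simp [blockEquiv]

theorem blockEquiv_inl_inr (i : Fin k) :
    blockEquiv σ s hB hBc (.inl (.inr i)) = Fin.castAdd (k + M) (σ (Fin.natAdd j i)) := by
  simp [blockEquiv]

theorem blockEquiv_inr (x : Fin k ⊕ Fin M) :
    blockEquiv σ s hB hBc (.inr x) = Fin.natAdd (j + k) (finSumEquivOfFinset hB hBc x) := by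
  simp [blockEquiv]

theorem assemble_mem_involutions (hs : ∀ i, s (s i) = i) (hρ : ρ ∈ involutions M) :
    assemble σ s hB hBc ρ ∈ involutions _ := by
  rw [mem_involutions] at *
  intro i
  obtain ⟨x, rfl⟩ := (blockEquiv σ s hB hBc).surjective i
  rw [assemble_blockEquiv, assemble_blockEquiv]
  congr 1
  rcases x with (i | i) | (i | i) <;> simp [core, hs, hρ]

theorem assemble_castAdd_castAdd (hs : ∀ i, s (s i) = i) (i : Fin j) :
    assemble σ s hB hBc ρ (Fin.castAdd (k + M) (σ (Fin.castAdd k i))) =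
      Fin.castAdd (k + M) (σ (Fin.castAdd k (s i))) := by
  have := assemble_blockEquiv (σ := σ) (ρ := ρ) (s := s) hB hBc (.inl (.inl (s i)))
  rw [blockEquiv_inl_inl, hs] at this
  rw [this]
  simp only [core, Equiv.coe_fn_mk]
  rw [blockEquiv_inl_inl, hs]

theorem assemble_castAdd_natAdd (i : Fin k) :
    assemble σ s hB hBc ρ (Fin.castAdd (k + M) (σ (Fin.natAdd j i))) =
      Fin.natAdd (j + k) (B.orderEmbOfFin hB i) := by
  rw [← blockEquiv_inl_inr hB hBc (s := s), assemble_blockEquiv]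
  simp only [core, Equiv.coe_fn_mk]
  rw [blockEquiv_inr, finSumEquivOfFinset_inl]

theorem assemble_natAdd_inl (i : Fin k) :
    assemble σ s hB hBc ρ (Fin.natAdd (j + k) (B.orderEmbOfFin hB i)) =
      Fin.castAdd (k + M) (σ (Fin.natAdd j i)) := by
  rw [← finSumEquivOfFinset_inl hB hBc, ← blockEquiv_inr hB hBc (σ := σ) (s := s),
    assemble_blockEquiv]
  simp only [core, Equiv.coe_fn_mk]
  rw [blockEquiv_inl_inr]

theorem assemble_natAdd_inr (i : Fin M) :
    assemble σ s hB hBc ρ (Fin.natAdd (j + k) (Bᶜ.orderEmbOfFin hBc i)) =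
      Fin.natAdd (j + k) (Bᶜ.orderEmbOfFin hBc (ρ i)) := by
  rw [← finSumEquivOfFinset_inr hB hBc, ← blockEquiv_inr hB hBc (σ := σ) (s := s),
    assemble_blockEquiv]
  simp only [core, Equiv.coe_fn_mk]
  rw [blockEquiv_inr, finSumEquivOfFinset_inr]

theorem assemble_strictMono (hs : ∀ i, s (s i) = i)
    (hsσ : ∀ i i', s i < s i' ↔ σ (Fin.castAdd k i) < σ (Fin.castAdd k i')) :
    StrictMono fun y => assemble σ s hB hBc ρ (Fin.castAdd (k + M) (σ y)) := by
  intro y z hyz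
  induction y using Fin.addCases with
  | left y =>
    induction z using Fin.addCases with
    | left z =>
      simp only [assemble_castAdd_castAdd hB hBc hs]
      refine (hsσ _ _).1 ?_
      rw [hs, hs]
      exact hyz
    | right z =>
      simp only [assemble_castAdd_castAdd hB hBc hs, assemble_castAdd_natAdd]
      rw [Fin.lt_def, Fin.val_castAdd, Fin.val_natAdd]
      omega
  | right y =>
    induction z using Fin.addCases with
    | left z =>
      rw [Fin.lt_def, Fin.val_castAdd, Fin.val_natAdd] at hyz
      omega
    | right z =>
      simp only [assemble_castAdd_natAdd]
      rw [Fin.lt_def, Fin.val_natAdd, Fin.val_natAdd] at *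
      have : y < z := by omega
      have := (B.orderEmbOfFin hB).strictMono this
      rw [Fin.lt_def] at this
      omega

theorem lowSet_assemble : lowSet (assemble σ s hB hBc ρ) = B := by
  ext p
  simp only [lowSet, Finset.mem_filter, Finset.mem_univ, true_and]
  obtain ⟨x, rfl⟩ := (finSumEquivOfFinset hB hBc).surjective p
  rcases x with i | i
  · rw [finSumEquivOfFinset_inl, assemble_natAdd_inl]
    simp
  · rw [finSumEquivOfFinset_inr, assemble_natAdd_inr]
    have := Finset.orderEmbOfFin_mem Bᶜ hBc i
    rw [Finset.mem_compl] at this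
    simp [this]

theorem assemble_injective : Function.Injective (assemble σ s hB hBc) := by
  intro ρ ρ' h
  ext i
  have := congrArg (fun π => π (Fin.natAdd (j + k) (Bᶜ.orderEmbOfFin hBc i))) h
  simp only [assemble_natAdd_inr] at this
  have := (Bᶜ.orderEmbOfFin hBc).injective (Fin.natAdd_injective _ _ this)
  rw [this]

theorem count_orderEmbOfFin {N k : ℕ} {B : Finset (Fin N)} (hB : B.card = k) (i : Fin k)
    (P : ℕ → Prop) [DecidablePred P] (hP : ∀ x : Fin N, P x ↔ x ∈ B) :
    Nat.count P (B.orderEmbOfFin hB i) = i := by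
  rw [Nat.count_eq_card_filter_range]
  have : Finset.filter P (Finset.range (B.orderEmbOfFin hB i)) =
      (Finset.Iio i).map ((B.orderEmbOfFin hB).toEmbedding.trans Fin.valEmbedding) := by
    ext x
    simp only [Finset.mem_filter, Finset.mem_range, Finset.mem_map, Finset.mem_Iio]
    constructor
    · rintro ⟨h1, h2⟩
      have hx : x < N := h1.trans (Fin.is_lt _)
      have hm := (hP ⟨x, hx⟩).1 h2
      rw [← Finset.mem_coe, ← Finset.range_orderEmbOfFin B hB] at hm
      obtain ⟨y, hy⟩ := hm
      refine ⟨y, ?_, congrArg Fin.val hy⟩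
      rw [← (B.orderEmbOfFin hB).lt_iff_lt, hy]
      exact h1
    · rintro ⟨y, hy, rfl⟩
      exact ⟨(B.orderEmbOfFin hB).strictMono hy, (hP _).2 (Finset.orderEmbOfFin_mem B hB y)⟩
  rw [this, Finset.card_map, Fin.card_Iio]

theorem shuffle_inl {N k : ℕ} {B : Finset (Fin N)} (hB : B.card = k) (u v : ℕ → ℕ)
    (i : Fin k) : shuffle u v (B.map Fin.valEmbedding) (B.orderEmbOfFin hB i) = u i := by
  rw [shuffle, if_pos, count_orderEmbOfFin hB i]
  · intro x
    simp [Fin.val_inj]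
  · simp [Fin.val_inj]

theorem shuffle_inr {N M : ℕ} {B : Finset (Fin N)} (hB : Bᶜ.card = M) (u v : ℕ → ℕ)
    (i : Fin M) : shuffle u v (B.map Fin.valEmbedding) (Bᶜ.orderEmbOfFin hB i) = v i := by
  rw [shuffle, if_neg, count_orderEmbOfFin hB i]
  · intro x
    simp [Fin.val_inj]
  · have := Finset.orderEmbOfFin_mem Bᶜ hB i
    rw [Finset.mem_compl] at this
    simpa [Fin.val_inj] using this

theorem wmaj_assemble :
    wmaj (fun i => val (assemble σ s hB hBc ρ) (j + k + i)) (k + M) =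
      wmaj (shuffle (fun i => if i < k then val σ (j + i) else 0) (fun i => j + k + 1 + val ρ i)
        (B.map Fin.valEmbedding)) (k + M) := by
  have key : ∀ p : Fin (k + M), val (assemble σ s hB hBc ρ) (j + k + p) =
      assemble σ s hB hBc ρ (Fin.natAdd (j + k) p) := fun p =>
    val_of_lt _ (by have := p.isLt; omega)
  refine wmaj_congr fun a ha b hb => ?_
  change val _ (j + k + (⟨a, ha⟩ : Fin (k + M))) < val _ (j + k + (⟨b, hb⟩ : Fin (k + M))) ↔
    shuffle _ _ _ (⟨a, ha⟩ : Fin (k + M)).val < shuffle _ _ _ (⟨b, hb⟩ : Fin (k + M)).val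
  generalize (⟨a, ha⟩ : Fin (k + M)) = x
  generalize (⟨b, hb⟩ : Fin (k + M)) = y
  have hu : ∀ i : Fin k, (if i.val < k then val σ (j + i) else 0) = σ (Fin.natAdd j i) :=
    fun i => by rw [if_pos i.isLt]; exact val_of_lt _ (by have := i.isLt; omega)
  have hv : ∀ i : Fin M, val ρ i = ρ i := fun i => val_of_lt _ i.isLt
  rw [key, key]
  obtain ⟨x, rfl⟩ := (finSumEquivOfFinset hB hBc).surjective x
  obtain ⟨y, rfl⟩ := (finSumEquivOfFinset hB hBc).surjective y
  rcases x with x | x <;> rcases y with y | y <;>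
  simp only [finSumEquivOfFinset_inl, finSumEquivOfFinset_inr, assemble_natAdd_inl,
    assemble_natAdd_inr, shuffle_inl, shuffle_inr, hu, hv, Fin.val_castAdd,
    Fin.val_natAdd]
  · constructor <;> intro <;> omega
  · constructor <;> intro <;> omega
  · rw [add_lt_add_iff_left, add_lt_add_iff_left, ← Fin.lt_def, OrderEmbedding.lt_iff_lt,
      Fin.lt_def]

end assembly

section disassembly

theorem mem_iff_lt_card_of_isLowerSet {m : ℕ} {S : Finset (Fin m)}
    (hS : ∀ y ∈ S, ∀ z ≤ y, z ∈ S) (y : Fin m) : y ∈ S ↔ y.val < S.card := by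
  constructor
  · intro hy
    have h := Finset.card_le_card (show Finset.Iic y ⊆ S from
      fun z hz => hS y hy z (Finset.mem_Iic.1 hz))
    rw [Fin.card_Iic] at h
    omega
  · intro hy
    by_contra hc
    have h := Finset.card_le_card (show S ⊆ Finset.Iio y from fun z hz => by
      rw [Finset.mem_Iio]
      by_contra hzy
      exact hc (hS z hz y (not_lt.1 hzy)))
    rw [Fin.card_Iio] at h
    omega

theorem card_high_eq_card_lowSet {m N : ℕ} {π : Equiv.Perm (Fin (m + N))}
    (hπ : ∀ i, π (π i) = i) (σ : Equiv.Perm (Fin m)) :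
    (Finset.univ.filter fun y : Fin m => ¬ (π (Fin.castAdd N (σ y))).val < m).card =
      (lowSet π).card := by
  have hinj : Function.Injective fun y : Fin m => π (Fin.castAdd N (σ y)) := fun y z h =>
    σ.injective (Fin.castAdd_injective m N (π.injective h))
  rw [← Finset.card_image_of_injective _ hinj,
    ← Finset.card_map (Fin.natAddEmb m : Fin N ↪ Fin (m + N))]
  congr 1
  ext x
  simp only [Finset.mem_image, Finset.mem_filter, Finset.mem_univ, true_and, Finset.mem_map,
    lowSet, Fin.natAddEmb_apply]
  constructor
  · rintro ⟨y, hy, rfl⟩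
    induction hx : π (Fin.castAdd N (σ y)) using Fin.addCases with
    | left z => rw [hx] at hy; simp at hy
    | right z =>
      refine ⟨z, ?_, rfl⟩
      rw [← hx, hπ]
      simp
  · rintro ⟨z, hz, rfl⟩
    have hz' : π (Fin.natAdd m z) = Fin.castAdd N ⟨_, hz⟩ := rfl
    refine ⟨σ.symm ⟨_, hz⟩, ?_, ?_⟩ <;> rw [Equiv.apply_symm_apply, ← hz', hπ]
    simp

theorem card_lowSet_le {m N : ℕ} {π : Equiv.Perm (Fin (m + N))}
    (hπ : ∀ i, π (π i) = i) : (lowSet π).card ≤ m := by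
  rw [← card_high_eq_card_lowSet hπ 1]
  exact (Finset.card_le_univ _).trans_eq (Fintype.card_fin m)

variable {j k M : ℕ} {σ : Equiv.Perm (Fin (j + k))} {B : Finset (Fin (k + M))}
  {π : Equiv.Perm (Fin ((j + k) + (k + M)))}

theorem lt_iff_lt_of_lowSet (hB : B.card = k) (hπ : ∀ i, π (π i) = i)
    (hmono : StrictMono fun y => π (Fin.castAdd (k + M) (σ y))) (hlow : lowSet π = B)
    (y : Fin (j + k)) : (π (Fin.castAdd (k + M) (σ y))).val < j + k ↔ y.val < j := by
  have h1 := card_high_eq_card_lowSet hπ σ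
  have h2 := Finset.card_filter_add_card_filter_not (s := (Finset.univ : Finset (Fin (j + k))))
    fun y => (π (Fin.castAdd (k + M) (σ y))).val < j + k
  rw [h1, hlow, hB, Finset.card_univ, Fintype.card_fin, Nat.add_right_cancel_iff] at h2
  have := mem_iff_lt_card_of_isLowerSet (S := Finset.univ.filter
    fun y : Fin (j + k) => (π (Fin.castAdd (k + M) (σ y))).val < j + k) (fun y hy z hz => by
      simp only [Finset.mem_filter, Finset.mem_univ, true_and] at *
      exact (Fin.le_def.1 (hmono.monotone hz)).trans_lt hy) y
  rwa [h2, Finset.mem_filter, and_iff_right (Finset.mem_univ _)] at this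

theorem apply_castAdd_natAdd (hB : B.card = k) (hπ : ∀ i, π (π i) = i)
    (hmono : StrictMono fun y => π (Fin.castAdd (k + M) (σ y))) (hlow : lowSet π = B)
    (i : Fin k) : π (Fin.castAdd (k + M) (σ (Fin.natAdd j i))) =
      Fin.natAdd (j + k) (B.orderEmbOfFin hB i) := by
  have hc : (B.map (Fin.natAddEmb (j + k))).card = k := by rw [Finset.card_map, hB]
  have h1 := Finset.orderEmbOfFin_unique hc
    (f := fun i => π (Fin.castAdd (k + M) (σ (Fin.natAdd j i)))) (fun i => by
      have hi := (lt_iff_lt_of_lowSet hB hπ hmono hlow (Fin.natAdd j i)).not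
      rw [Finset.mem_map]
      induction hx : π (Fin.castAdd (k + M) (σ (Fin.natAdd j i))) using Fin.addCases with
      | left z => rw [hx] at hi; simp at hi
      | right z =>
        refine ⟨z, ?_, rfl⟩
        rw [← hlow, lowSet, Finset.mem_filter, ← hx, hπ]
        simp)
    (fun x y hxy => hmono (by
      rw [Fin.lt_def] at *
      simpa using hxy))
  have h2 := Finset.orderEmbOfFin_unique hc
    (f := fun i => Fin.natAdd (j + k) (B.orderEmbOfFin hB i)) (fun i => by
      rw [Finset.mem_map]
      exact ⟨_, Finset.orderEmbOfFin_mem B hB i, rfl⟩)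
    (fun x y hxy => by
      have := (B.orderEmbOfFin hB).strictMono hxy
      rw [Fin.lt_def] at *
      simpa using this)
  exact congrFun (h1.trans h2.symm) i

/-- Every involution with small-value pattern `σ` arises from `assemble`. -/
theorem exists_assemble_eq (hB : B.card = k) (hBc : Bᶜ.card = M) (hπ : ∀ i, π (π i) = i)
    (hmono : StrictMono fun y => π (Fin.castAdd (k + M) (σ y))) (hlow : lowSet π = B)
    {s : Equiv.Perm (Fin j)}
    (hsσ : ∀ i i', s i < s i' ↔ σ (Fin.castAdd k i) < σ (Fin.castAdd k i')) :
    (∀ i, s (s i) = i) ∧ ∃ ρ ∈ involutions M, assemble σ s hB hBc ρ = π := by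
  have hlt := lt_iff_lt_of_lowSet hB hπ hmono hlow
  have hg : ∀ i : Fin j, ∃ i' : Fin j, π (Fin.castAdd (k + M) (σ (Fin.castAdd k i))) =
      Fin.castAdd (k + M) (σ (Fin.castAdd k i')) := by
    intro i
    have hi : (π (Fin.castAdd (k + M) (σ (Fin.castAdd k i)))).val < j + k :=
      (hlt _).2 (by simp)
    have hz : π (Fin.castAdd (k + M) (σ (Fin.castAdd k i))) =
      Fin.castAdd (k + M) ⟨_, hi⟩ := rfl
    obtain ⟨y, hy⟩ := σ.surjective ⟨_, hi⟩
    rw [← hy] at hz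
    have hyj : y.val < j := (hlt y).1 (by rw [← hz, hπ]; simp)
    exact ⟨⟨y, hyj⟩, hz⟩
  choose g hg using hg
  have hgg : ∀ i, g (g i) = i := fun i => by
    have h := hg (g i)
    rw [← hg i, hπ] at h
    exact (Fin.castAdd_injective _ _ (σ.injective (Fin.castAdd_injective _ _ h))).symm
  have hs : s = Function.Involutive.toPerm g hgg := by
    refine perm_eq_of_lt_iff fun i i' => ?_
    rw [hsσ]
    have h := hmono.lt_iff_lt (a := Fin.castAdd k (g i)) (b := Fin.castAdd k (g i'))
    simp only [hg, hgg] at h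
    exact h
  have hs' : ∀ i, s i = g i := fun i => by rw [hs]; rfl
  have hss : ∀ i, s (s i) = i := fun i => by rw [hs', hs', hgg]
  refine ⟨hss, ?_⟩
  set H := blockEquiv σ s hB hBc with hH
  have c1 : ∀ i, π (H (.inl (.inl i))) = H (.inl (.inl (s i))) := fun i => by
    simp only [hH, blockEquiv_inl_inl, hg, hs', hgg]
  have c2 : ∀ i, π (H (.inl (.inr i))) = H (.inr (.inl i)) := fun i => by
    simp only [hH, blockEquiv_inl_inr, blockEquiv_inr, finSumEquivOfFinset_inl]
    exact apply_castAdd_natAdd hB hπ hmono hlow i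
  have c3 : ∀ i, π (H (.inr (.inl i))) = H (.inl (.inr i)) := fun i => by
    rw [← c2, hπ]
  have c4 : ∀ i, ∃ r, π (H (.inr (.inr i))) = H (.inr (.inr r)) := fun i => by
    obtain ⟨x, hx⟩ := H.surjective (π (H (.inr (.inr i))))
    have hx' := congrArg π hx
    rw [hπ] at hx'
    rcases x with (x | x) | (x | x)
    · rw [c1] at hx'; simpa using H.injective hx'
    · rw [c2] at hx'; simpa using H.injective hx'
    · rw [c3] at hx'; simpa using H.injective hx'
    · exact ⟨x, hx.symm⟩
  choose r hr using c4
  have hrr : ∀ i, r (r i) = i := fun i => by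
    have h := hr (r i)
    rw [← hr i, hπ] at h
    simpa using (H.injective h).symm
  refine ⟨Function.Involutive.toPerm r hrr, mem_involutions.2 hrr, ?_⟩
  ext x
  obtain ⟨x, rfl⟩ := H.surjective x
  rw [hH, assemble_blockEquiv, ← hH]
  congr 1
  rcases x with (x | x) | (x | x)
  · rw [c1]; rfl
  · rw [c2]; rfl
  · rw [c3]; rfl
  · rw [hr]; rfl

end disassembly

section fibres

variable {j k M : ℕ}

theorem mem_involutionsC {m N : ℕ} {σ : Equiv.Perm (Fin m)} {π : Equiv.Perm (Fin (m + N))} :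
    π ∈ involutionsC (m + N) σ ↔
      (∀ i, π (π i) = i) ∧ StrictMono fun y => π (Fin.castAdd N (σ y)) := by
  rw [involutionsC, Finset.mem_filter, ← mem_involutions]
  refine and_congr_right fun h => ?_
  rw [exists_prop_of_true (Nat.le_add_right m N), vLow_eq_iff h]
  rfl

theorem mem_jSet_iff {σ : Equiv.Perm (Fin (j + k))} :
    j ∈ jSet σ ↔ ∀ i, pInit σ j (Nat.le_add_right j k) (pInit σ j (Nat.le_add_right j k) i) = i := by
  rw [jSet, Finset.mem_filter, exists_prop_of_true (Nat.le_add_right j k), Finset.mem_range,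
    and_iff_right (by omega)]
  simp [Equiv.ext_iff]

theorem sum_fibre_lowSet (q : ℝ) (σ : Equiv.Perm (Fin (j + k))) {B : Finset (Fin (k + M))}
    (hB : B.card = k) :
    ∑ π ∈ (involutionsC ((j + k) + (k + M)) σ).filter (lowSet · = B),
        q ^ maj (pTail π (j + k)) =
      if j ∈ jSet σ then ∑ ρ ∈ involutions M,
        q ^ wmaj (shuffle (fun i => if i < k then val σ (j + i) else 0)
          (fun i => j + k + 1 + val ρ i) (B.map Fin.valEmbedding)) (k + M) else 0 := by
  have hBc : Bᶜ.card = M := by rw [Finset.card_compl, hB, Fintype.card_fin]; omega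
  have hsσ := pInit_lt_pInit σ (Nat.le_add_right j k)
  split_ifs with hJ
  · rw [mem_jSet_iff] at hJ
    symm
    refine Finset.sum_bij (fun ρ _ => assemble σ (pInit σ j (Nat.le_add_right j k)) hB hBc ρ) ?_ ?_ ?_ ?_
    · intro ρ hρ
      rw [Finset.mem_filter, mem_involutionsC, ← mem_involutions]
      exact ⟨⟨assemble_mem_involutions hB hBc hJ hρ, assemble_strictMono hB hBc hJ hsσ⟩,
        lowSet_assemble hB hBc⟩
    · intro ρ _ ρ' _ h
      exact assemble_injective hB hBc h
    · intro π hπ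
      rw [Finset.mem_filter, mem_involutionsC] at hπ
      obtain ⟨-, ρ, hρ, h⟩ := exists_assemble_eq hB hBc hπ.1.1 hπ.1.2 hπ.2 hsσ
      exact ⟨ρ, hρ, h⟩
    · intro ρ _
      rw [maj_pTail, ← wmaj_assemble hB hBc, Nat.add_sub_cancel_left]
  · refine Finset.sum_eq_zero fun π hπ => (hJ ?_).elim
    rw [Finset.mem_filter, mem_involutionsC] at hπ
    exact mem_jSet_iff.2 (exists_assemble_eq hB hBc hπ.1.1 hπ.1.2 hπ.2 hsσ).1

theorem sum_powersetCard_univ_fin {k N : ℕ} (f : Finset ℕ → ℝ) :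
    ∑ B ∈ Finset.powersetCard k (Finset.univ : Finset (Fin N)), f (B.map Fin.valEmbedding) =
      ∑ B ∈ Finset.powersetCard k (Finset.range N), f B := by
  have h : Finset.range N = (Finset.univ : Finset (Fin N)).map Fin.valEmbedding := by
    rw [Fin.map_valEmbedding_univ, Nat.Iio_eq_range]
  rw [h, Finset.powersetCard_map, Finset.sum_map]
  rfl

theorem wmaj_add_left (c : ℕ) (w : ℕ → ℕ) (N : ℕ) : wmaj (fun i => c + w i) N = wmaj w N :=
  wmaj_congr fun _ _ _ _ => Nat.add_lt_add_iff_left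

theorem sum_fibre_card {q : ℝ} (hq : 0 < q) (σ : Equiv.Perm (Fin (j + k))) :
    ∑ B ∈ Finset.powersetCard k (Finset.univ : Finset (Fin (k + M))),
      ∑ π ∈ (involutionsC ((j + k) + (k + M)) σ).filter (lowSet · = B),
        q ^ maj (pTail π (j + k)) =
      if j ∈ jSet σ then q ^ maj (pTail σ j) * qMulti q k M * tq q M else 0 := by
  rw [Finset.sum_congr rfl fun B hB => sum_fibre_lowSet q σ (Finset.mem_powersetCard.1 hB).2]
  split_ifs with hJ
  · have hu : wmaj (fun i => if i < k then val σ (j + i) else 0) k = maj (pTail σ j) := by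
      rw [maj_pTail, Nat.add_sub_cancel_left]
      exact wmaj_congr fun a ha b hb => by simp only [if_pos ha, if_pos hb]
    rw [Finset.sum_comm, tq, Finset.mul_sum]
    refine Finset.sum_congr rfl fun ρ _ => ?_
    rw [sum_powersetCard_univ_fin (N := k + M) fun B => q ^ wmaj (shuffle _ _ B) (k + M),
      sum_shuffle hq, hu, wmaj_add_left, ← maj_eq_wmaj]
    · ring
    · intro i i'
      split_ifs with hi
      · rw [val_of_lt _ (show j + i < j + k by omega)]
        have := (σ ⟨j + i, by omega⟩).isLt
        omega
      · omega
  · simp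

theorem sum_involutionsC {q : ℝ} (hq : 0 < q) {m N : ℕ} (hN : m ≤ N) (σ : Equiv.Perm (Fin m)) :
    ∑ π ∈ involutionsC (m + N) σ, q ^ maj (pTail π m) =
      ∑ j ∈ jSet σ, q ^ maj (pTail σ j) * (qBinom q N (m - j) * tq q (N - (m - j))) := by
  have hcard : ∀ k, k ≤ m → ∑ B ∈ Finset.powersetCard k (Finset.univ : Finset (Fin N)),
      ∑ π ∈ (involutionsC (m + N) σ).filter (lowSet · = B), q ^ maj (pTail π m) =
      if m - k ∈ jSet σ then
        q ^ maj (pTail σ (m - k)) * (qBinom q N k * tq q (N - k)) else 0 := by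
    intro k hk
    obtain ⟨j, rfl⟩ := Nat.exists_eq_add_of_le' hk
    obtain ⟨M, rfl⟩ := Nat.exists_eq_add_of_le (hk.trans hN)
    rw [Nat.add_sub_cancel, Nat.add_sub_cancel_left (n := k) (m := M), qBinom_add hq,
      sum_fibre_card hq, mul_assoc]
  rw [← Finset.sum_fiberwise_of_maps_to (t := Finset.univ.powerset) (g := lowSet)
    fun π _ => Finset.mem_powerset.2 (Finset.subset_univ (lowSet π)),
    Finset.sum_powerset, Finset.card_univ, Fintype.card_fin]
  rw [← Finset.sum_subset (Finset.range_subset_range.2 (Nat.succ_le_succ hN)),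
    Finset.sum_congr rfl fun k hk => hcard k (Nat.lt_succ_iff.1 (Finset.mem_range.1 hk)),
    ← Finset.sum_range_reflect]
  · have hJ : jSet σ = (Finset.range (m + 1)).filter (· ∈ jSet σ) := by
      ext j
      simp only [Finset.mem_filter, Finset.mem_range, jSet]
      tauto
    rw [hJ, Finset.sum_filter, ← hJ]
    refine Finset.sum_congr rfl fun j hj => ?_
    have hj := Finset.mem_range.1 hj
    rw [show m - (m + 1 - 1 - j) = j by omega, show m + 1 - 1 - j = m - j by omega]
  · intro k _ hk
    rw [Finset.mem_range, not_lt] at hk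
    refine Finset.sum_eq_zero fun B hB => Finset.sum_eq_zero fun π hπ => ?_
    rw [Finset.mem_filter, mem_involutionsC] at hπ
    have := card_lowSet_le hπ.1.1
    rw [hπ.2, (Finset.mem_powersetCard.1 hB).2] at this
    omega

end fibres

section splicing

variable {j k : ℕ}

theorem card_compl_of_card_eq {B : Finset (Fin (j + k))} (hB : B.card = j) : Bᶜ.card = k := by
  rw [Finset.card_compl, hB, Fintype.card_fin, Nat.add_sub_cancel_left]

/-- The permutation whose letters smaller than `j` form the word `α` at the positions `B`, and
whose remaining letters form the word `β`. -/
noncomputable def splice {B : Finset (Fin (j + k))} (hB : B.card = j)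
    (α : Equiv.Perm (Fin j)) (β : Equiv.Perm (Fin k)) : Equiv.Perm (Fin (j + k)) :=
  (finSumEquivOfFinset hB (card_compl_of_card_eq hB)).symm.trans
    ((Equiv.sumCongr α β).trans finSumFinEquiv)

variable {B : Finset (Fin (j + k))} (hB : B.card = j) (α : Equiv.Perm (Fin j))
  (β : Equiv.Perm (Fin k))

theorem splice_inl (i : Fin j) :
    splice hB α β (B.orderEmbOfFin hB i) = Fin.castAdd k (α i) := by
  rw [splice, Equiv.trans_apply, ← finSumEquivOfFinset_inl hB (card_compl_of_card_eq hB),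
    Equiv.symm_apply_apply]
  simp

theorem splice_inr (i : Fin k) :
    splice hB α β (Bᶜ.orderEmbOfFin (card_compl_of_card_eq hB) i) = Fin.natAdd j (β i) := by
  rw [splice, Equiv.trans_apply, ← finSumEquivOfFinset_inr hB (card_compl_of_card_eq hB),
    Equiv.symm_apply_apply]
  simp

theorem splice_lt_iff (p : Fin (j + k)) : (splice hB α β p).val < j ↔ p ∈ B := by
  obtain ⟨x, rfl⟩ := (finSumEquivOfFinset hB (card_compl_of_card_eq hB)).surjective p
  rcases x with i | i
  · rw [finSumEquivOfFinset_inl, splice_inl]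
    simp
  · have := Finset.mem_compl.1 (Finset.orderEmbOfFin_mem Bᶜ (card_compl_of_card_eq hB) i)
    rw [finSumEquivOfFinset_inr, splice_inr]
    simp [this]

theorem splice_bijective :
    Function.Bijective fun x : {B : Finset (Fin (j + k)) // B.card = j} ×
      Equiv.Perm (Fin j) × Equiv.Perm (Fin k) => splice x.1.2 x.2.1 x.2.2 := by
  rw [Fintype.bijective_iff_injective_and_card]
  constructor
  · rintro ⟨⟨B, hB⟩, α, β⟩ ⟨⟨B', hB'⟩, α', β'⟩ h
    dsimp only at h
    obtain rfl : B = B' := by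
      ext p
      rw [← splice_lt_iff hB α β, h, splice_lt_iff]
    have hα : α = α' := by
      ext i
      have := congrArg (fun π => π (B.orderEmbOfFin hB i)) h
      simp only [splice_inl] at this
      rw [Fin.castAdd_injective _ _ this]
    have hβ : β = β' := by
      ext i
      have := congrArg (fun π => π (Bᶜ.orderEmbOfFin (card_compl_of_card_eq hB) i)) h
      simp only [splice_inr] at this
      rw [Fin.natAdd_injective _ _ this]
    rw [hα, hβ]
  · simp only [Fintype.card_prod, Fintype.card_finset_len, Fintype.card_perm, Fintype.card_fin]
    rw [← Nat.add_choose_mul_factorial_mul_factorial j k, mul_assoc, Nat.choose_symm_add]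

theorem sum_perm_eq_sum_splice (F : Equiv.Perm (Fin (j + k)) → ℝ) :
    ∑ π, F π = ∑ B : {B : Finset (Fin (j + k)) // B.card = j},
      ∑ α : Equiv.Perm (Fin j), ∑ β : Equiv.Perm (Fin k), F (splice B.2 α β) := by
  rw [← splice_bijective.sum_comp, Fintype.sum_prod_type]
  simp only [Fintype.sum_prod_type]

theorem wmaj_splice :
    maj (splice hB α β) = wmaj (shuffle (fun i => if i < j then val α i else 0)
      (fun i => j + 1 + val β i) (B.map Fin.valEmbedding)) (j + k) := by
  rw [maj_eq_wmaj]
  have key : ∀ p : Fin (j + k), val (splice hB α β) p = splice hB α β p :=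
    fun p => val_of_lt _ p.isLt
  refine wmaj_congr fun a ha b hb => ?_
  change val _ (⟨a, ha⟩ : Fin (j + k)).val < val _ (⟨b, hb⟩ : Fin (j + k)).val ↔
    shuffle _ _ _ (⟨a, ha⟩ : Fin (j + k)).val < shuffle _ _ _ (⟨b, hb⟩ : Fin (j + k)).val
  generalize (⟨a, ha⟩ : Fin (j + k)) = x
  generalize (⟨b, hb⟩ : Fin (j + k)) = y
  have hu : ∀ i : Fin j, (if i.val < j then val α i else 0) = α i :=
    fun i => by rw [if_pos i.isLt]; exact val_of_lt _ i.isLt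
  have hv : ∀ i : Fin k, val β i = β i := fun i => val_of_lt _ i.isLt
  rw [key, key]
  obtain ⟨x, rfl⟩ := (finSumEquivOfFinset hB (card_compl_of_card_eq hB)).surjective x
  obtain ⟨y, rfl⟩ := (finSumEquivOfFinset hB (card_compl_of_card_eq hB)).surjective y
  rcases x with x | x <;> rcases y with y | y <;>
  simp only [finSumEquivOfFinset_inl, finSumEquivOfFinset_inr, splice_inl, splice_inr,
    shuffle_inl, shuffle_inr, hu, hv, Fin.val_castAdd, Fin.val_natAdd]
  · constructor <;> intro <;> omega
  · constructor <;> intro <;> omega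
  · rw [add_lt_add_iff_left, add_lt_add_iff_left]

/-- MacMahon's theorem on the distribution of the major index. -/
theorem sum_maj {q : ℝ} (hq : 0 < q) (n : ℕ) :
    ∑ π : Equiv.Perm (Fin n), q ^ maj π = qFact q n := by
  induction n with
  | zero => simp [maj, qFact_zero]
  | succ n ih =>
    rw [sum_perm_eq_sum_splice, Finset.sum_comm, qFact_succ, ← ih, Finset.sum_mul]
    refine Finset.sum_congr rfl fun α _ => ?_
    have h := sum_shuffle hq (u := fun i => if i < n then val α i else 0)
      (v := fun i => n + 1 + val (1 : Equiv.Perm (Fin 1)) i) (fun i i' => by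
        split_ifs with hi
        · rw [val_of_lt _ hi]
          have := (α ⟨i, hi⟩).isLt
          omega
        · omega) n 1
    have hu : wmaj (fun i => if i < n then val α i else 0) n = maj α := by
      rw [maj_eq_wmaj]
      exact wmaj_congr fun a ha b hb => by simp only [if_pos ha, if_pos hb]
    have hM : qMulti q n 1 = qInt q (n + 1) := by
      have := (qFact_pos hq n).ne'
      rw [qMulti, qFact_succ, qFact_succ, qFact_zero]
      simp [qInt]
      field_simp
    rw [hu, wmaj_add_left, ← maj_eq_wmaj, hM, show maj (1 : Equiv.Perm (Fin 1)) = 0 by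
      simp [maj], add_zero] at h
    rw [← h, ← sum_powersetCard_univ_fin (N := n + 1)
      fun B => q ^ wmaj (shuffle _ _ B) (n + 1)]
    rw [Finset.sum_subtype (p := fun B : Finset (Fin (n + 1)) => B.card = n) _
      (fun B => by simp [Finset.mem_powersetCard])]
    refine Finset.sum_congr rfl fun B _ => ?_
    rw [Fintype.sum_unique, wmaj_splice]
    rfl

theorem pInit_splice_symm : pInit (splice hB α β)⁻¹ j (Nat.le_add_right j k) = α⁻¹ := by
  symm
  rw [eq_pInit_iff]
  have key : ∀ i, (splice hB α β)⁻¹ (Fin.castLE (Nat.le_add_right j k) i) =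
      B.orderEmbOfFin hB (α⁻¹ i) := fun i => by
    rw [Equiv.Perm.inv_eq_iff_eq, splice_inl]
    simp
    rfl
  intro i i'
  rw [key, key, OrderEmbedding.lt_iff_lt]

theorem maj_pTail_splice_symm : maj (pTail (splice hB α β)⁻¹ j) = maj β⁻¹ := by
  rw [maj_pTail, maj_eq_wmaj, Nat.add_sub_cancel_left]
  have key : ∀ i (h : i < k), val (splice hB α β)⁻¹ (j + i) =
      Bᶜ.orderEmbOfFin (card_compl_of_card_eq hB) (β⁻¹ ⟨i, h⟩) := fun i h => by
    rw [val_of_lt _ (Nat.add_lt_add_left h j)]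
    congr 1
    rw [Equiv.Perm.inv_eq_iff_eq, splice_inr]
    simp
  refine wmaj_congr fun a ha b hb => ?_
  rw [key a ha, key b hb, val_of_lt _ ha, val_of_lt _ hb, ← Fin.lt_def, OrderEmbedding.lt_iff_lt,
    Fin.lt_def]

theorem sum_mem_jSet {q : ℝ} (hq : 0 < q) :
    (∑ σ : Equiv.Perm (Fin (j + k)), if j ∈ jSet σ then q ^ maj (pTail σ j) else 0) =
      (j + k).choose j * (involutions j).card * qFact q k := by
  classical
  rw [← Equiv.sum_comp (Equiv.inv (Equiv.Perm (Fin (j + k)))), sum_perm_eq_sum_splice]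
  have key : ∀ (B : {B : Finset (Fin (j + k)) // B.card = j}) α β,
      (if j ∈ jSet (splice B.2 α β)⁻¹ then q ^ maj (pTail (splice B.2 α β)⁻¹ j) else 0) =
        if α⁻¹ ∈ involutions j then q ^ maj β⁻¹ else 0 := fun B α β => by
    simp only [mem_jSet_iff, pInit_splice_symm, maj_pTail_splice_symm, mem_involutions]
  simp only [Equiv.inv_apply, key]
  rw [Finset.sum_const, Finset.card_univ, Fintype.card_finset_len, Fintype.card_fin, nsmul_eq_mul,
    mul_assoc]
  congr 1
  rw [← sum_maj hq k, ← Equiv.sum_comp (Equiv.inv (Equiv.Perm (Fin k)))]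
  refine (Equiv.sum_comp (Equiv.inv (Equiv.Perm (Fin j))) fun α =>
    ∑ β : Equiv.Perm (Fin k), if α ∈ involutions j then q ^ maj β⁻¹ else 0).trans ?_
  simp only [Equiv.inv_apply]
  rw [Finset.card_eq_sum_ones, Nat.cast_sum, Finset.sum_mul, involutions, Finset.sum_filter]
  refine Finset.sum_congr rfl fun α _ => ?_
  by_cases h : α * α = 1 <;> simp [h]

/-- The generating function of all involutions, summed over the pattern of small values. -/
theorem sum_involutions {q : ℝ} (hq : 0 < q) {m N : ℕ} (hN : m ≤ N) :
    ∑ π ∈ involutions (m + N), q ^ maj (pTail π m) =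
      ∑ j ∈ Finset.range (m + 1), m.choose j * (involutions j).card * qFact q (m - j) *
        (qBinom q N (m - j) * tq q (N - (m - j))) := by
  classical
  have h1 : ∑ π ∈ involutions (m + N), q ^ maj (pTail π m) =
      ∑ σ : Equiv.Perm (Fin m), ∑ π ∈ involutionsC (m + N) σ, q ^ maj (pTail π m) := by
    rw [← Finset.sum_fiberwise_of_maps_to (t := Finset.univ)
      (g := fun π => vLow π m (Nat.le_add_right m N)) fun π _ => Finset.mem_univ _]
    refine Finset.sum_congr rfl fun σ _ => ?_
    congr 1
    ext π
    rw [Finset.mem_filter, involutionsC, Finset.mem_filter,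
      exists_prop_of_true (Nat.le_add_right m N)]
  have h2 : ∀ σ : Equiv.Perm (Fin m), jSet σ = (Finset.range (m + 1)).filter (· ∈ jSet σ) := by
    intro σ
    ext j
    simp only [Finset.mem_filter, Finset.mem_range, jSet]
    tauto
  rw [h1, Finset.sum_congr rfl fun σ _ => by
    rw [sum_involutionsC hq hN σ, h2 σ, Finset.sum_filter], Finset.sum_comm]
  refine Finset.sum_congr rfl fun j hj => ?_
  obtain ⟨k, rfl⟩ := Nat.exists_eq_add_of_le (Nat.lt_succ_iff.1 (Finset.mem_range.1 hj))
  simp only [← mul_assoc]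
  generalize qBinom q N (j + k - j) = x, tq q (N - (j + k - j)) = y
  rw [congrArg (qFact q) (Nat.add_sub_cancel_left (n := j) (m := k)), ← sum_mem_jSet hq, Finset.sum_mul,
    Finset.sum_mul]
  refine Finset.sum_congr rfl fun σ _ => ?_
  rw [ite_mul, zero_mul, ite_mul, zero_mul]

end splicing

section blocks

variable {n : ℕ}

theorem val_fin (π : Equiv.Perm (Fin n)) (i : Fin n) : val π i = π i := val_of_lt π i.isLt

theorem val_injective (π : Equiv.Perm (Fin n)) {i j : ℕ} (hi : i < n) (hj : j < n)
    (h : val π i = val π j) : i = j := by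
  rw [val_of_lt π hi, val_of_lt π hj, Fin.val_inj, π.injective.eq_iff] at h
  exact congrArg Fin.val h

/-- The set of descents of `π`. -/
def desc (π : Equiv.Perm (Fin n)) : Finset ℕ :=
  (Finset.range n).filter fun s => val π s < val π (s - 1)

/-- The set of ascents of `π`. -/
def asc (π : Equiv.Perm (Fin n)) : Finset ℕ :=
  (Finset.range n).filter fun s => val π (s - 1) < val π s

theorem maj_eq_sum_desc (π : Equiv.Perm (Fin n)) : maj π = ∑ s ∈ desc π, s := by
  rw [maj_eq_wmaj, wmaj, desc, Finset.sum_filter]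

theorem sum_asc_add_maj (π : Equiv.Perm (Fin n)) :
    ∑ s ∈ asc π, s + maj π = ∑ s ∈ Finset.range n, s := by
  rw [maj_eq_wmaj, wmaj, asc, Finset.sum_filter, ← Finset.sum_add_distrib]
  refine Finset.sum_congr rfl fun s hs => ?_
  have hs := Finset.mem_range.1 hs
  rcases Nat.eq_zero_or_pos s with rfl | h0
  · simp
  · have : val π s ≠ val π (s - 1) := fun h => by
      have := val_injective π hs (by omega) h
      omega
    split_ifs <;> omega

/-- The number of elements of `S` to the right of `i`: the index of the block containing `i`
in the subdivision of the positions by `S`. -/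
def blk (S : Finset ℕ) (i : ℕ) : ℕ := (S.filter (i < ·)).card

theorem blk_antitone (S : Finset ℕ) : Antitone (blk S) := fun i j hij =>
  Finset.card_le_card fun s hs => by
    simp only [Finset.mem_filter] at *
    exact ⟨hs.1, hij.trans_lt hs.2⟩

theorem blk_lt {S : Finset ℕ} {i s : ℕ} (hs : s ∈ S) (hi : i < s) : blk S s < blk S i :=
  Finset.card_lt_card <| by
    rw [Finset.ssubset_iff_of_subset]
    · exact ⟨s, by simp [hs, hi]⟩
    · intro x hx
      simp only [Finset.mem_filter] at *
      exact ⟨hx.1, hi.trans hx.2⟩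

theorem blk_pred {S : Finset ℕ} {s : ℕ} (h0 : 0 < s) (hs : s ∉ S) : blk S (s - 1) = blk S s := by
  rw [blk, blk]
  congr 1
  ext x
  simp only [Finset.mem_filter]
  refine and_congr_right fun hx => ?_
  have : x ≠ s := fun h => hs (h ▸ hx)
  omega

theorem blk_lt_of_subset {S : Finset ℕ} (hS : S ⊆ Finset.range n) {i : ℕ} (hi : i < n) :
    blk S i < n := by
  have : blk S i ≤ (Finset.Ioo i n).card := Finset.card_le_card fun s hs => by
    rw [Finset.mem_filter] at hs
    exact Finset.mem_Ioo.2 ⟨hs.2, Finset.mem_range.1 (hS hs.1)⟩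
  rw [Nat.card_Ioo] at this
  omega

theorem sum_blk {S : Finset ℕ} (hS : S ⊆ Finset.range n) :
    ∑ i : Fin n, blk S i = ∑ s ∈ S, s := by
  simp only [blk, Finset.card_filter]
  rw [Finset.sum_comm]
  refine Finset.sum_congr rfl fun s hs => ?_
  have := Finset.mem_range.1 (hS hs)
  rw [Fin.sum_univ_eq_sum_range (fun i => if i < s then 1 else 0), ← Finset.card_filter]
  convert Finset.card_range s using 2
  ext x
  simp only [Finset.mem_filter, Finset.mem_range]
  omega

theorem forall_blk_iff {R : ℕ → ℕ → Prop} (hR : ∀ i j k, R i j → R j k → R i k) {S : Finset ℕ} :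
    (∀ s, 0 < s → s < n → s ∉ S → R (s - 1) s) ↔
      ∀ i j, i < j → j < n → blk S i = blk S j → R i j := by
  constructor
  · intro h i j hij
    induction j, hij using Nat.le_induction with
    | base =>
      intro hj hb
      exact h (i + 1) i.succ_pos hj fun hs => (blk_lt hs i.lt_succ_self).ne' hb
    | succ j hij ih =>
      intro hj hb
      have hb' : blk S j = blk S (j + 1) := le_antisymm
        ((blk_antitone S (Nat.le_of_succ_le hij)).trans_eq hb) (blk_antitone S j.le_succ)
      exact hR _ _ _ (ih (by omega) (hb.trans hb'.symm))
        (h (j + 1) j.succ_pos hj fun hs => (blk_lt hs j.lt_succ_self).ne' hb')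
  · intro h s h0 hs hS
    exact h _ _ (by omega) hs (blk_pred h0 hS)

theorem desc_subset_iff (π : Equiv.Perm (Fin n)) (S : Finset ℕ) :
    desc π ⊆ S ↔ ∀ i j : Fin n, i < j → blk S i = blk S j → π i < π j := by
  have h1 : desc π ⊆ S ↔ ∀ s, 0 < s → s < n → s ∉ S → val π (s - 1) < val π s := by
    simp only [Finset.subset_iff, desc, Finset.mem_filter, Finset.mem_range]
    constructor
    · intro h s h0 hs hS
      refine lt_of_le_of_ne (not_lt.1 fun hc => hS (h ⟨hs, hc⟩)) fun hc => ?_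
      have := val_injective π (by omega) hs hc
      omega
    · rintro h s ⟨hs, hlt⟩
      by_contra hS
      rcases Nat.eq_zero_or_pos s with rfl | h0
      · exact lt_irrefl _ hlt
      · exact lt_asymm hlt (h s h0 hs hS)
  rw [h1, forall_blk_iff (R := fun i j => val π i < val π j) fun _ _ _ => lt_trans]
  refine ⟨fun h i j hij hb => ?_, fun h i j hij hj hb => ?_⟩
  · have := h i j hij j.isLt hb
    rwa [val_fin, val_fin] at this
  · have := h ⟨i, hij.trans hj⟩ ⟨j, hj⟩ hij hb
    rwa [val_of_lt π hj, val_of_lt π (hij.trans hj)]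

theorem asc_subset_iff (π : Equiv.Perm (Fin n)) (S : Finset ℕ) :
    asc π ⊆ S ↔ ∀ i j : Fin n, i < j → blk S i = blk S j → π j < π i := by
  have h1 : asc π ⊆ S ↔ ∀ s, 0 < s → s < n → s ∉ S → val π s < val π (s - 1) := by
    simp only [Finset.subset_iff, asc, Finset.mem_filter, Finset.mem_range]
    constructor
    · intro h s h0 hs hS
      refine lt_of_le_of_ne (not_lt.1 fun hc => hS (h ⟨hs, hc⟩)) fun hc => ?_
      have := val_injective π hs (by omega) hc
      omega
    · rintro h s ⟨hs, hlt⟩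
      by_contra hS
      rcases Nat.eq_zero_or_pos s with rfl | h0
      · exact lt_irrefl _ hlt
      · exact lt_asymm hlt (h s h0 hs hS)
  rw [h1, forall_blk_iff (R := fun i j => val π j < val π i) fun _ _ _ h h' => lt_trans h' h]
  refine ⟨fun h i j hij hb => ?_, fun h i j hij hj hb => ?_⟩
  · have := h i j hij j.isLt hb
    rwa [val_fin, val_fin] at this
  · have := h ⟨i, hij.trans hj⟩ ⟨j, hj⟩ hij hb
    rwa [val_of_lt π hj, val_of_lt π (hij.trans hj)]

theorem eq_of_card_fibre_eq {α : Type*} [LinearOrder α] {h h' : Fin n → α} (hh : Antitone h)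
    (hh' : Antitone h')
    (hc : ∀ a, (Finset.univ.filter (h · = a)).card = (Finset.univ.filter (h' · = a)).card) :
    h = h' := by
  have hm : (Finset.univ : Finset (Fin n)).val.map h = Finset.univ.val.map h' := by
    ext a
    simp only [Multiset.count_map]
    simpa only [Finset.card_def, Finset.filter_val, eq_comm] using hc a
  rw [Fin.univ_val_map, Fin.univ_val_map, Multiset.coe_eq_coe] at hm
  have hs : ∀ {g : Fin n → α}, Antitone g → (List.ofFn g).Pairwise (· ≥ ·) := fun hg =>
    List.pairwise_ofFn.2 fun i j hij => hg hij.le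
  exact List.ofFn_injective (hm.eq_of_pairwise (fun a b _ _ h1 h2 => le_antisymm h2 h1)
    (hs hh) (hs hh'))

variable {f f' : Fin n → ℕ} {π π' : Equiv.Perm (Fin n)}

theorem lt_iff_of_fibres (hf : Antitone f) (hπ : ∀ i, π (π i) = i)
    (hinc : ∀ i j, i < j → f i = f j → π i < π j) (i j : Fin n) :
    π i < π j ↔ f (π j) < f (π i) ∨ f (π i) = f (π j) ∧ i < j := by
  constructor
  · intro h
    refine (hf h.le).lt_or_eq.imp id fun he => ⟨he.symm, ?_⟩
    simpa only [hπ] using hinc _ _ h he.symm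
  · rintro (h | ⟨he, h⟩)
    · exact hf.reflect_lt h
    · by_contra hc
      rcases (not_lt.1 hc).lt_or_eq with hc | hc
      · have := hinc _ _ hc he.symm
        rw [hπ, hπ] at this
        exact lt_asymm h this
      · exact h.ne' (π.injective hc)

theorem eq_of_card_block_eq (hf : Antitone f) (hf' : Antitone f') (hπ : ∀ i, π (π i) = i)
    (hπ' : ∀ i, π' (π' i) = i) (hinc : ∀ i j, i < j → f i = f j → π i < π j)
    (hinc' : ∀ i j, i < j → f' i = f' j → π' i < π' j)
    (hc : ∀ x : ℕ × ℕ, (Finset.univ.filter fun i => (f i, f (π i)) = x).card =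
      (Finset.univ.filter fun i => (f' i, f' (π' i)) = x).card) : π = π' := by
  have anti : ∀ {g : Fin n → ℕ} {ρ : Equiv.Perm (Fin n)}, Antitone g →
      (∀ i j, i < j → g i = g j → ρ i < ρ j) →
      Antitone fun i => toLex (g i, g (ρ i)) := by
    intro g ρ hg hρ i j hij
    rcases hij.lt_or_eq with hij | rfl
    · rw [Prod.Lex.toLex_le_toLex]
      exact (hg hij.le).lt_or_eq.imp id fun he => ⟨he, hg (hρ i j hij he.symm).le⟩
    · exact le_rfl
  have h := eq_of_card_fibre_eq (anti hf hinc) (anti hf' hinc') fun a => hc (ofLex a)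
  have hff : f = f' := funext fun i => congrArg (fun x => (ofLex x).1) (congrFun h i)
  have hfπ : ∀ i, f (π i) = f' (π' i) := fun i =>
    congrArg (fun x => (ofLex x).2) (congrFun h i)
  refine perm_eq_of_lt_iff fun i j => ?_
  rw [lt_iff_of_fibres hf hπ hinc, lt_iff_of_fibres hf' hπ' hinc', hfπ, hfπ]

end blocks

section reversal

variable {n : ℕ} {ι κ : Type*}

/-- The permutation reversing every fibre of `g`. -/
noncomputable def revFibres (g : Fin n → ι) : Equiv.Perm (Fin n) :=
  Equiv.ofFiberEquiv (f := g) (g := g) fun c =>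
    letI : Fintype {i // g i = c} := Fintype.ofFinite _
    (Fintype.orderIsoFinOfCardEq {i // g i = c} rfl).symm.toEquiv.trans
      (Fin.revPerm.trans (Fintype.orderIsoFinOfCardEq {i // g i = c} rfl).toEquiv)

theorem apply_revFibres (g : Fin n → ι) (i : Fin n) : g (revFibres g i) = g i :=
  Equiv.ofFiberEquiv_map _ i

theorem revFibres_lt (g : Fin n → ι) {i j : Fin n} (hg : g i = g j) (hij : i < j) :
    revFibres g j < revFibres g i := by
  generalize hc : g j = c at hg
  have key : ∀ (i) (hi : g i = c), revFibres g i =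
      letI : Fintype {i // g i = c} := Fintype.ofFinite _
      (Fintype.orderIsoFinOfCardEq {i // g i = c} rfl
        (Fin.rev ((Fintype.orderIsoFinOfCardEq {i // g i = c} rfl).symm ⟨i, hi⟩))).val := by
    rintro i rfl
    rfl
  rw [key i hg, key j hc]
  simp only [Subtype.coe_lt_coe, OrderIso.lt_iff_lt, Fin.rev_lt_rev]
  exact hij

theorem eq_one_of_fibres {g : Fin n → ι} {τ : Equiv.Perm (Fin n)} (hτ : ∀ i, g (τ i) = g i)
    (hlt : ∀ i j, g i = g j → i < j → τ i < τ j) : τ = 1 := by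
  have hle : ∀ i, i ≤ τ i := fun i => by
    induction i using WellFoundedLT.induction with
    | ind i ih =>
      by_contra! hc
      exact (ih _ hc).not_gt (hlt _ _ (hτ i) hc)
  have hsum := Equiv.sum_comp τ fun i => (i : ℕ)
  ext i
  exact ((Finset.sum_eq_sum_iff_of_le (f := fun i : Fin n => (i : ℕ))
    (g := fun i => (τ i : ℕ))
    fun i _ => hle i).1 hsum.symm i (Finset.mem_univ i)).symm

theorem revFibres_mul_self (g : Fin n → ι) : revFibres g * revFibres g = 1 :=
  eq_one_of_fibres (g := g) (fun i => by simp [apply_revFibres]) fun _ _ hg hij =>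
    revFibres_lt g (by simp only [apply_revFibres, hg]) (revFibres_lt g hg hij)

theorem revFibres_revFibres (g : Fin n → ι) (i : Fin n) : revFibres g (revFibres g i) = i :=
  Equiv.ext_iff.1 (revFibres_mul_self g) i

theorem eq_revFibres {g : Fin n → ι} {v : Equiv.Perm (Fin n)} (hv : ∀ i, g (v i) = g i)
    (hlt : ∀ i j, g i = g j → i < j → v j < v i) : v = revFibres g := by
  have h : v * revFibres g = 1 := eq_one_of_fibres (g := g)
    (fun i => by simp [apply_revFibres, hv]) fun _ _ hg hij =>
      hlt _ _ (by simp only [apply_revFibres, hg]) (revFibres_lt g hg hij)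
  rw [eq_inv_of_mul_eq_one_left h, inv_eq_iff_mul_eq_one, revFibres_mul_self]

/-- Exchanges the involutions increasing on the blocks of `f` with those decreasing on them. -/
noncomputable def blockFlip (f : Fin n → ℕ) (π : Equiv.Perm (Fin n)) : Equiv.Perm (Fin n) :=
  revFibres f * π * revFibres (fun i => (f i, f (π i))) * revFibres f

variable {f : Fin n → ℕ} {π : Equiv.Perm (Fin n)} {r : Fin n → Fin n → Prop}

theorem fst_revFibres (f g : Fin n → ℕ) (i : Fin n) :
    f (revFibres (fun i => (f i, g i)) i) = f i :=
  congrArg Prod.fst (apply_revFibres (fun i => (f i, g i)) i)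

theorem snd_revFibres (f g : Fin n → ℕ) (i : Fin n) :
    g (revFibres (fun i => (f i, g i)) i) = g i :=
  congrArg Prod.snd (apply_revFibres (fun i => (f i, g i)) i)

theorem flip_apply (f : Fin n → ℕ) (π : Equiv.Perm (Fin n)) (i : Fin n) :
    blockFlip f π i =
      revFibres f (π (revFibres (fun i => (f i, f (π i))) (revFibres f i))) := rfl

theorem apply_flip (f : Fin n → ℕ) (π : Equiv.Perm (Fin n)) (i : Fin n) :
    f (blockFlip f π i) = f (π (revFibres f i)) := by
  rw [flip_apply, apply_revFibres f, snd_revFibres f fun i => f (π i)]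

theorem revFibres_comm (hr : r = (· < ·) ∨ r = (· > ·)) (hπ : ∀ i, π (π i) = i)
    (h : ∀ i j, i < j → f i = f j → r (π i) (π j)) (i : Fin n) :
    π (revFibres (fun i => (f i, f (π i))) (π i)) = revFibres (fun i => (f i, f (π i))) i := by
  have hinv : π * π = 1 := Equiv.ext hπ
  refine Equiv.ext_iff.1 (eq_revFibres (v := π * revFibres (fun i => (f i, f (π i))) * π)
    (fun i => ?_) fun i j hg hij => ?_) i
  · simp only [Equiv.Perm.mul_apply, hπ]
    rw [fst_revFibres f, snd_revFibres f fun i => f (π i), hπ]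
  · simp only [Equiv.Perm.mul_apply]
    have hg1 := congrArg Prod.fst hg
    have hg2 := congrArg Prod.snd hg
    dsimp only at hg1 hg2
    have hg' : (f (π i), f (π (π i))) = (f (π j), f (π (π j))) := by rw [hπ, hπ, hg1, hg2]
    have hf' : ∀ a b, f (π a) = f (π b) →
        f (revFibres (fun i => (f i, f (π i))) (π a)) =
          f (revFibres (fun i => (f i, f (π i))) (π b)) := fun a b hab => by
      rw [fst_revFibres f, fst_revFibres f, hab]
    have h1 := h _ _ hij hg1
    rcases hr with rfl | rfl
    · exact h _ _ (revFibres_lt _ hg' h1) (hf' _ _ hg2.symm)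
    · exact h _ _ (revFibres_lt _ hg'.symm h1) (hf' _ _ hg2)

theorem flip_involutive (hr : r = (· < ·) ∨ r = (· > ·)) (hπ : ∀ i, π (π i) = i)
    (h : ∀ i j, i < j → f i = f j → r (π i) (π j)) (i : Fin n) : blockFlip f π (blockFlip f π i) = i := by
  simp only [flip_apply, revFibres_revFibres]
  have := revFibres_comm hr hπ h
  rw [← this, hπ, hπ, revFibres_revFibres, revFibres_revFibres]

theorem lt_iff_lt_of_blocks (hf : Antitone f) {x y x' y' : Fin n} (hxy : f x ≠ f y)
    (hx : f x' = f x) (hy : f y' = f y) : x' < y' ↔ x < y := by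
  have key : ∀ {a b}, f a ≠ f b → (a < b ↔ f b < f a) := fun hab =>
    ⟨fun h => lt_of_le_of_ne (hf h.le) hab.symm, fun h => hf.reflect_lt h⟩
  rw [key hxy, key (by rwa [hx, hy]), hx, hy]

theorem flip_lt (hf : Antitone f) (hr : r = (· < ·) ∨ r = (· > ·))
    (h : ∀ i j, i < j → f i = f j → r (π i) (π j)) (i j : Fin n) (hij : i < j)
    (he : f i = f j) : r (blockFlip f π j) (blockFlip f π i) := by
  have hw := revFibres_lt f he hij
  have he' : f (revFibres f j) = f (revFibres f i) := by simp only [apply_revFibres, he]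
  by_cases hg : f (π (revFibres f i)) = f (π (revFibres f j))
  · have h1 := h _ _ (revFibres_lt (fun i => (f i, f (π i))) (by rw [he', hg]) hw)
      (by rw [fst_revFibres f, fst_revFibres f, he'])
    have h2 := (snd_revFibres f (fun i => f (π i)) (revFibres f i)).trans
      (hg.trans (snd_revFibres f (fun i => f (π i)) (revFibres f j)).symm)
    rcases hr with rfl | rfl
    · exact revFibres_lt f h2 h1
    · exact revFibres_lt f h2.symm h1
  · have h1 := h _ _ hw he'
    rcases hr with rfl | rfl
    · exact (lt_iff_lt_of_blocks hf (Ne.symm hg) (apply_flip f π j) (apply_flip f π i)).2 h1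
    · exact (lt_iff_lt_of_blocks hf hg (apply_flip f π i) (apply_flip f π j)).2 h1

theorem flip_flip (f : Fin n → ℕ) (π : Equiv.Perm (Fin n)) : blockFlip f (blockFlip f π) = π := by
  have hv : revFibres f * revFibres (fun i => (f i, f (π i))) * revFibres f =
      revFibres (fun i => (f i, f (blockFlip f π i))) := by
    refine eq_revFibres (fun i => ?_) fun i j hg hij => ?_
    · simp only [Equiv.Perm.mul_apply, apply_flip, apply_revFibres, fst_revFibres,
        revFibres_revFibres]
      rw [snd_revFibres f fun i => f (π i)]
    · simp only [apply_flip, Prod.mk.injEq] at hg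
      have hw := revFibres_lt f hg.1 hij
      refine revFibres_lt f ?_ (revFibres_lt (fun i => (f i, f (π i))) ?_ hw)
      · simp only [fst_revFibres, apply_revFibres, hg.1]
      · rw [apply_revFibres f, apply_revFibres f, hg.1, hg.2]
  ext i
  rw [flip_apply, ← hv]
  simp only [Equiv.Perm.mul_apply, flip_apply, revFibres_revFibres]

theorem card_increasing_eq_card_decreasing (hf : Antitone f) :
    ((involutions n).filter fun π => ∀ i j, i < j → f i = f j → π i < π j).card =
      ((involutions n).filter fun π => ∀ i j, i < j → f i = f j → π j < π i).card := by
  refine Finset.card_nbij' (blockFlip f) (blockFlip f) ?_ ?_ (fun π _ => flip_flip f π)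
    fun π _ => flip_flip f π
  · intro π hπ
    simp only [Finset.coe_filter, Set.mem_ofPred_eq, mem_involutions] at *
    exact ⟨flip_involutive (r := (· < ·)) (.inl rfl) hπ.1 hπ.2,
      flip_lt (r := (· < ·)) hf (.inl rfl) hπ.2⟩
  · intro π hπ
    simp only [Finset.coe_filter, Set.mem_ofPred_eq, mem_involutions] at *
    exact ⟨flip_involutive (r := (· > ·)) (.inr rfl) hπ.1 hπ.2,
      flip_lt (r := (· > ·)) hf (.inr rfl) hπ.2⟩

/-- The number of involutions with descent set in `S` is the number with ascent set in `S`. -/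
theorem card_desc_subset_eq (n : ℕ) (S : Finset ℕ) :
    ((involutions n).filter (desc · ⊆ S)).card = ((involutions n).filter (asc · ⊆ S)).card := by
  simp only [desc_subset_iff, asc_subset_iff]
  exact card_increasing_eq_card_decreasing fun i j hij => blk_antitone S hij

theorem sum_superset_weight {R : Finset ℕ} {D : Finset ℕ} (hD : D ⊆ R) (x : ℕ → ℝ) :
    ∑ S ∈ R.powerset with D ⊆ S, (∏ i ∈ S, x i) * ∏ i ∈ R \ S, (1 - x i) = ∏ i ∈ D, x i := by
  have h := Finset.prod_add x (fun i => 1 - x i) (R \ D)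
  simp only [add_sub_cancel, Finset.prod_const_one] at h
  rw [← mul_one (∏ i ∈ D, x i)]
  refine Eq.trans ?_ (congrArg _ h.symm)
  rw [Finset.mul_sum]
  refine Finset.sum_bij' (fun S _ => S \ D) (fun T _ => D ∪ T) ?_ ?_ ?_ ?_ ?_
  · intro S hS
    simp only [Finset.mem_filter, Finset.mem_powerset] at *
    exact Finset.sdiff_subset_sdiff hS.1 le_rfl
  · intro T hT
    simp only [Finset.mem_filter, Finset.mem_powerset] at *
    exact ⟨Finset.union_subset hD (hT.trans Finset.sdiff_subset), Finset.subset_union_left⟩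
  · intro S hS
    exact Finset.union_sdiff_of_subset (Finset.mem_filter.1 hS).2
  · intro T hT
    have := Finset.disjoint_of_subset_left (Finset.mem_powerset.1 hT) Finset.sdiff_disjoint
    rw [Finset.union_sdiff_left, Finset.sdiff_eq_self_of_disjoint this]
  · intro S hS
    have hDS := (Finset.mem_filter.1 hS).2
    have h1 : (R \ D) \ (S \ D) = R \ S := by
      ext a
      have := @hDS a
      simp only [Finset.mem_sdiff]
      tauto
    rw [h1, ← mul_assoc, ← Finset.prod_sdiff hDS (f := x), mul_comm (∏ i ∈ S \ D, x i)]

theorem sum_pow_maj_eq_sum_pow_asc (p : ℝ) (n : ℕ) :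
    ∑ π ∈ involutions n, p ^ maj π = ∑ π ∈ involutions n, p ^ ∑ s ∈ asc π, s := by
  have key : ∀ d : Equiv.Perm (Fin n) → Finset ℕ, (∀ π, d π ⊆ Finset.range n) →
      ∑ π ∈ involutions n, p ^ ∑ s ∈ d π, s = ∑ S ∈ (Finset.range n).powerset,
        ((∏ i ∈ S, p ^ i) * ∏ i ∈ Finset.range n \ S, (1 - p ^ i)) *
          ((involutions n).filter (d · ⊆ S)).card := by
    intro d hd
    rw [Finset.sum_congr rfl fun π _ => by
      rw [← Finset.prod_pow_eq_pow_sum, ← sum_superset_weight (hd π), Finset.sum_filter],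
      Finset.sum_comm]
    refine Finset.sum_congr rfl fun S _ => ?_
    rw [← Finset.sum_filter, Finset.sum_const, nsmul_eq_mul, mul_comm]
  simp only [maj_eq_sum_desc]
  rw [key desc fun π => Finset.filter_subset _ _, key asc fun π => Finset.filter_subset _ _]
  simp only [card_desc_subset_eq]

theorem tq_eq_pow_mul_tq_inv {q : ℝ} (hq : 0 < q) (n : ℕ) :
    tq q n = q ^ (∑ s ∈ Finset.range n, s) * tq q⁻¹ n := by
  rw [tq, tq, sum_pow_maj_eq_sum_pow_asc q⁻¹, Finset.mul_sum]
  refine Finset.sum_congr rfl fun π _ => ?_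
  rw [← sum_asc_add_maj π, pow_add, inv_pow]
  field_simp

end reversal

section bounds

variable {n : ℕ}

/-- The number of positions of `π` in block `x.1` whose letters lie in block `x.2`. -/
def blockCount (π : Equiv.Perm (Fin n)) (x : ℕ × ℕ) : ℕ :=
  (Finset.univ.filter fun i : Fin n => (blk (desc π) i, blk (desc π) (π i)) = x).card

/-- The pairs of blocks other than the pair of last blocks. -/
def blockPairs (n : ℕ) : Finset (ℕ × ℕ) := (Finset.range n ×ˢ Finset.range n).erase (0, 0)

theorem desc_subset_range (π : Equiv.Perm (Fin n)) : desc π ⊆ Finset.range n :=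
  Finset.filter_subset _ _

theorem blocks_mem (π : Equiv.Perm (Fin n)) (i : Fin n) :
    (blk (desc π) i, blk (desc π) (π i)) ∈ Finset.range n ×ˢ Finset.range n :=
  Finset.mem_product.2 ⟨Finset.mem_range.2 (blk_lt_of_subset (desc_subset_range π) i.isLt),
    Finset.mem_range.2 (blk_lt_of_subset (desc_subset_range π) (π i).isLt)⟩

theorem sum_blockCount (π : Equiv.Perm (Fin n)) :
    ∑ x ∈ Finset.range n ×ˢ Finset.range n, blockCount π x = n := by
  simpa [blockCount] using (Finset.card_eq_sum_card_fiberwise (s := Finset.univ)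
    fun i _ => Finset.mem_coe.2 (blocks_mem π i)).symm

theorem sq_pow_maj (r : ℝ) (π : Equiv.Perm (Fin n)) :
    (r ^ 2) ^ maj π = ∏ x ∈ blockPairs n, (r ^ (x.1 + x.2)) ^ blockCount π x := by
  have h1 : 2 * maj π = ∑ i : Fin n, (blk (desc π) i + blk (desc π) (π i)) := by
    rw [Finset.sum_add_distrib, Equiv.sum_comp π fun i => blk (desc π) i,
      sum_blk (desc_subset_range π), ← maj_eq_sum_desc, two_mul]
  rw [blockPairs, Finset.prod_erase _ (by simp), ← pow_mul, h1, ← Finset.prod_pow_eq_pow_sum,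
    ← Finset.prod_fiberwise_of_maps_to (fun i _ => blocks_mem π i)]
  refine Finset.prod_congr rfl fun x _ => ?_
  rw [Finset.prod_congr rfl (g := fun _ => r ^ (x.1 + x.2)) fun i hi => by
    rw [← (Finset.mem_filter.1 hi).2], Finset.prod_const, blockCount]

theorem blockCount_injOn : Set.InjOn (fun (π : Equiv.Perm (Fin n)) (x : blockPairs n) =>
    blockCount π x) (involutions n) := by
  intro π hπ π' hπ' h
  rw [Finset.mem_coe, mem_involutions] at hπ hπ'
  have hK : ∀ x ∈ blockPairs n, blockCount π x = blockCount π' x := fun x hx =>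
    congrFun h ⟨x, hx⟩
  refine eq_of_card_block_eq (fun i j hij => blk_antitone (desc π) hij)
    (fun i j hij => blk_antitone (desc π') hij) hπ hπ' ((desc_subset_iff π _).1 subset_rfl)
    ((desc_subset_iff π' _).1 subset_rfl) fun x => ?_
  change blockCount π x = blockCount π' x
  by_cases hx : x ∈ blockPairs n
  · exact hK x hx
  by_cases hx' : x ∈ Finset.range n ×ˢ Finset.range n
  · have hs := (sum_blockCount π).trans (sum_blockCount π').symm
    obtain rfl : x = (0, 0) := by
      by_contra hne
      exact hx (Finset.mem_erase.2 ⟨hne, hx'⟩)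
    rw [← Finset.add_sum_erase _ _ hx', ← Finset.add_sum_erase _ _ hx'] at hs
    have : ∑ x ∈ blockPairs n, blockCount π x = ∑ x ∈ blockPairs n, blockCount π' x :=
      Finset.sum_congr rfl hK
    rw [blockPairs] at this
    omega
  · have : ∀ ρ : Equiv.Perm (Fin n), blockCount ρ x = 0 := fun ρ => by
      rw [blockCount, Finset.card_eq_zero, Finset.filter_eq_empty_iff]
      rintro i - rfl
      exact hx' (blocks_mem ρ i)
    rw [this, this]

theorem sum_pow_le_exp {x r : ℝ} (hx0 : 0 ≤ x) (hxr : x ≤ r) (hr : r < 1) (N : ℕ) :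
    ∑ c ∈ Finset.range N, x ^ c ≤ Real.exp (x / (1 - r)) := by
  have hx1 : x < 1 := hxr.trans_lt hr
  calc ∑ c ∈ Finset.range N, x ^ c ≤ (1 - x)⁻¹ := by
        rw [← tsum_geometric_of_lt_one hx0 hx1]
        exact (summable_geometric_of_lt_one hx0 hx1).sum_le_tsum _ fun i _ => pow_nonneg hx0 i
    _ = x / (1 - x) + 1 := by field_simp [(sub_pos.2 hx1).ne']; ring
    _ ≤ x / (1 - r) + 1 := by gcongr
    _ ≤ Real.exp (x / (1 - r)) := Real.add_one_le_exp _

theorem sum_range_pow_le {r : ℝ} (hr0 : 0 ≤ r) (hr : r < 1) (N : ℕ) :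
    ∑ c ∈ Finset.range N, r ^ c ≤ (1 - r)⁻¹ := by
  rw [← tsum_geometric_of_lt_one hr0 hr]
  exact (summable_geometric_of_lt_one hr0 hr).sum_le_tsum _ fun i _ => pow_nonneg hr0 i

theorem tq_sq_le {r : ℝ} (hr0 : 0 < r) (hr : r < 1) (n : ℕ) :
    tq (r ^ 2) n ≤ Real.exp ((1 - r)⁻¹ ^ 2 / (1 - r)) := by
  have hle : ∀ x ∈ blockPairs n, r ^ (x.1 + x.2) ≤ r := fun x hx => by
    have hx := (Finset.mem_erase.1 hx).1
    refine pow_le_of_le_one hr0.le hr.le fun h => hx ?_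
    ext <;> dsimp only <;> omega
  calc tq (r ^ 2) n
      = ∑ π ∈ involutions n, ∏ x : blockPairs n,
          (r ^ (x.val.1 + x.val.2)) ^ blockCount π x := by
        refine Finset.sum_congr rfl fun π _ => ?_
        rw [sq_pow_maj, ← Finset.prod_coe_sort]
    _ = ∑ c ∈ (involutions n).image fun π (x : blockPairs n) => blockCount π x,
          ∏ x : blockPairs n, (r ^ (x.val.1 + x.val.2)) ^ c x := by
        rw [Finset.sum_image blockCount_injOn]
    _ ≤ ∑ c ∈ Fintype.piFinset fun _ : blockPairs n => Finset.range (n + 1),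
          ∏ x : blockPairs n, (r ^ (x.val.1 + x.val.2)) ^ c x := by
        refine Finset.sum_le_sum_of_subset_of_nonneg ?_ fun c _ _ =>
          Finset.prod_nonneg fun x _ => by positivity
        intro c hc
        obtain ⟨π, -, rfl⟩ := Finset.mem_image.1 hc
        refine Fintype.mem_piFinset.2 fun x => Finset.mem_range.2 (Nat.lt_succ_iff.2 ?_)
        exact (Finset.card_le_univ _).trans_eq (Fintype.card_fin n)
    _ = ∏ x : blockPairs n, ∑ c ∈ Finset.range (n + 1), (r ^ (x.val.1 + x.val.2)) ^ c :=
        (Finset.prod_univ_sum _ _).symm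
    _ ≤ ∏ x : blockPairs n, Real.exp (r ^ (x.val.1 + x.val.2) / (1 - r)) :=
        Finset.prod_le_prod (fun x _ => Finset.sum_nonneg fun c _ => by positivity)
          fun x _ => sum_pow_le_exp (by positivity) (hle x x.2) hr _
    _ = Real.exp ((∑ x ∈ blockPairs n, r ^ (x.1 + x.2)) / (1 - r)) := by
        rw [← Real.exp_sum, ← Finset.sum_div, Finset.sum_coe_sort (blockPairs n) fun x : ℕ × ℕ =>
          r ^ (x.1 + x.2)]
    _ ≤ Real.exp ((1 - r)⁻¹ ^ 2 / (1 - r)) := by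
        have h1 : ∑ x ∈ blockPairs n, r ^ (x.1 + x.2) ≤
            (∑ c ∈ Finset.range n, r ^ c) ^ 2 := by
          rw [sq, Finset.sum_mul_sum, ← Finset.sum_product']
          simp only [← pow_add]
          exact Finset.sum_le_sum_of_subset_of_nonneg (Finset.erase_subset _ _)
            fun _ _ _ => by positivity
        have h2 := sum_range_pow_le hr0.le hr n
        have h3 : 0 < 1 - r := sub_pos.2 hr
        gcongr
        refine h1.trans ?_
        gcongr

/-- The permutation `π` with a largest letter appended as a fixed point. -/
def extend (π : Equiv.Perm (Fin n)) : Equiv.Perm (Fin (n + 1)) :=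
  finSumFinEquiv.permCongr (Equiv.sumCongr π (1 : Equiv.Perm (Fin 1)))

theorem extend_castSucc (π : Equiv.Perm (Fin n)) (i : Fin n) :
    extend π i.castSucc = (π i).castSucc := by
  change finSumFinEquiv _ = _
  rw [show i.castSucc = finSumFinEquiv (Sum.inl i : Fin n ⊕ Fin 1) from rfl,
    Equiv.trans_apply, Equiv.symm_apply_apply]
  rfl

theorem extend_last (π : Equiv.Perm (Fin n)) : extend π (Fin.last n) = Fin.last n := by
  change finSumFinEquiv _ = _
  rw [show Fin.last n = finSumFinEquiv (Sum.inr 0 : Fin n ⊕ Fin 1) from rfl,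
    Equiv.trans_apply, Equiv.symm_apply_apply]
  rfl

theorem maj_extend (π : Equiv.Perm (Fin n)) : maj (extend π) = maj π := by
  have h : ∀ i < n, val (extend π) i = val π i := fun i hi => by
    rw [val_of_lt _ hi, val_of_lt _ (by omega)]
    exact congrArg Fin.val (extend_castSucc π ⟨i, hi⟩)
  have hn : val (extend π) n = n := by
    rw [val_of_lt _ n.lt_succ_self]
    exact congrArg Fin.val (extend_last π)
  rw [maj_eq_wmaj, maj_eq_wmaj, wmaj_succ, if_neg, add_zero]
  · exact wmaj_congr fun i hi j hj => by rw [h i hi, h j hj]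
  · rw [hn, not_lt, val_of_lt _ (by omega)]
    exact Nat.lt_succ_iff.1 (Fin.isLt _)

theorem tq_mono {q : ℝ} (hq : 0 < q) : Monotone (tq q) := by
  refine monotone_nat_of_le_succ fun n => ?_
  have hinj : Set.InjOn (extend (n := n)) (involutions n) := fun π _ π' _ h => by
    ext i
    have := congrArg (fun ρ => ρ i.castSucc) h
    simp only [extend_castSucc, Fin.castSucc_inj] at this
    rw [this]
  calc tq q n = ∑ π ∈ (involutions n).image extend, q ^ maj π := by
        rw [Finset.sum_image hinj]
        simp only [maj_extend, tq]
    _ ≤ tq q (n + 1) := by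
        refine Finset.sum_le_sum_of_subset_of_nonneg ?_ fun _ _ _ => by positivity
        intro ρ hρ
        obtain ⟨π, hπ, rfl⟩ := Finset.mem_image.1 hρ
        rw [mem_involutions] at *
        intro i
        induction i using Fin.lastCases with
        | last => rw [extend_last, extend_last]
        | cast i => rw [extend_castSucc, extend_castSucc, hπ]

theorem tq_zero (q : ℝ) : tq q 0 = 1 := by
  simp [tq, involutions, maj, Finset.filter_true_of_mem]

theorem one_le_tq {q : ℝ} (hq : 0 < q) (n : ℕ) : 1 ≤ tq q n :=
  (tq_zero q).symm.trans_le (tq_mono hq n.zero_le)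

theorem tq_pos {q : ℝ} (hq : 0 < q) (n : ℕ) : 0 < tq q n := one_pos.trans_le (one_le_tq hq n)

theorem tendsto_tq_succ_div {q : ℝ} (hq : 0 < q) (hq1 : q < 1) :
    Filter.Tendsto (fun n => tq q (n + 1) / tq q n) Filter.atTop (nhds 1) := by
  have hb : BddAbove (Set.range (tq q)) := by
    refine ⟨Real.exp ((1 - √q)⁻¹ ^ 2 / (1 - √q)), Set.forall_mem_range.2 fun n => ?_⟩
    have := tq_sq_le (Real.sqrt_pos.2 hq) ((Real.sqrt_lt' one_pos).2 (by simpa using hq1)) n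
    rwa [Real.sq_sqrt hq.le] at this
  have hL := tendsto_atTop_ciSup (tq_mono hq) hb
  have hpos : 0 < ⨆ n, tq q n := (tq_pos hq 0).trans_le (le_ciSup hb 0)
  have := (hL.comp (Filter.tendsto_add_atTop_nat 1)).div hL hpos.ne'
  rwa [div_self hpos.ne'] at this

end bounds

section asymptotics

open Filter Topology

variable {q : ℝ}

theorem qBinom_succ_self_add (hq : 0 < q) (k M : ℕ) :
    qBinom q (k + 1 + M) k * qInt q (M + 1) = qBinom q (k + 1 + M) (k + 1) * qInt q (k + 1) := by
  have hk := (qFact_pos hq k).ne'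
  have hM := (qFact_pos hq M).ne'
  have hk' := (qInt_succ_pos hq k).ne'
  have hM' := (qInt_succ_pos hq M).ne'
  rw [qBinom_add hq (k + 1), show k + 1 + M = k + (M + 1) by ring, qBinom_add hq k, qMulti,
    qMulti, qFact_succ q M, qFact_succ q k, show k + 1 + M = k + (M + 1) by ring]
  field_simp

theorem tq_one_succ_succ (n : ℕ) : tq 1 (n + 2) = tq 1 (n + 1) + (n + 1) * tq 1 n := by
  have h := sum_involutions one_pos (m := 1) (N := n + 1) (by omega)
  have hb : qBinom 1 (n + 1) 1 = n + 1 := by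
    have := qBinom_succ_self_add one_pos 0 n
    simpa [qBinom, qInt, Nat.add_comm 1 n, eq_comm] using this
  simp [Finset.sum_range_succ, qFact, qInt, hb, qBinom, involutions,
    Finset.filter_true_of_mem] at h
  rw [show 1 + (n + 1) = n + 2 by ring] at h
  simp only [tq, one_pow, Finset.sum_const, nsmul_eq_mul, mul_one, involutions] at h ⊢
  linarith

theorem tq_one_bounds (n : ℕ) :
    (n + 1) * tq 1 n ^ 2 ≤ tq 1 (n + 1) ^ 2 ∧
      tq 1 (n + 1) ^ 2 ≤ 2 * tq 1 n * tq 1 (n + 1) + (n + 1) * tq 1 n ^ 2 := by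
  induction n with
  | zero =>
    have h0 := tq_zero 1
    have h1 : tq 1 1 = 1 := by
      have : (involutions 1).card = 1 := by decide
      simp [tq, this]
    norm_num [h0, h1]
  | succ n ih =>
    have ha := tq_pos one_pos n
    have hb := tq_pos one_pos (n + 1)
    obtain ⟨h1, h2⟩ := ih
    rw [tq_one_succ_succ]
    push_cast
    have hn : (0 : ℝ) ≤ n := n.cast_nonneg
    generalize tq 1 n = a at *
    generalize tq 1 (n + 1) = b at *
    constructor
    · nlinarith [mul_nonneg (by linarith : (0 : ℝ) ≤ n + 1) (sub_nonneg.2 h2)]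
    · nlinarith [mul_nonneg (by linarith : (0 : ℝ) ≤ n + 1) (sub_nonneg.2 h1)]

theorem tendsto_tq_one : Tendsto (fun n => tq 1 (n + 1) / (tq 1 n * qInt 1 (n + 1))) atTop
    (𝓝 0) := by
  have hlim : Tendsto (fun n : ℕ => √(9 * (1 / ((n : ℝ) + 1)))) atTop (𝓝 0) := by
    have := (tendsto_one_div_add_atTop_nhds_zero_nat (𝕜 := ℝ)).const_mul 9
    have h := (Real.continuous_sqrt.tendsto _).comp this
    rw [mul_zero, Real.sqrt_zero] at h
    exact h
  refine squeeze_zero (fun n => ?_) (fun n => ?_) hlim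
  · have := tq_pos one_pos n
    have := tq_pos one_pos (n + 1)
    have := qInt_succ_pos one_pos n
    positivity
  · refine Real.le_sqrt_of_sq_le ?_
    have ha := tq_pos one_pos n
    have h := (tq_one_bounds n).2
    have hn : (0 : ℝ) ≤ n := n.cast_nonneg
    have hI : qInt 1 (n + 1) = n + 1 := by simp [qInt]
    rw [hI]
    generalize tq 1 n = a at *
    generalize tq 1 (n + 1) = b at *
    rw [div_pow, div_le_iff₀ (by positivity)]
    have : 9 * (1 / ((n : ℝ) + 1)) * (a * (n + 1)) ^ 2 = 9 * (n + 1) * a ^ 2 := by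
      field_simp
    rw [this]
    nlinarith [sq_nonneg (b - 2 * a), mul_nonneg hn (sq_nonneg a)]

theorem tendsto_qInt (hq : 0 < q) (hq1 : q < 1) :
    Tendsto (fun n => qInt q (n + 1)) atTop (𝓝 (1 - q)⁻¹) :=
  (hasSum_geometric_of_lt_one hq.le hq1).tendsto_sum_nat.comp (tendsto_add_atTop_nat 1)

theorem qInt_succ_inv (hq : 0 < q) (n : ℕ) : qInt q (n + 1) = q ^ n * qInt q⁻¹ (n + 1) := by
  rw [qInt, qInt, Finset.mul_sum, ← Finset.sum_range_reflect]
  refine Finset.sum_congr rfl fun i hi => ?_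
  have hi := Finset.mem_range.1 hi
  rw [inv_pow, ← pow_sub₀ _ hq.ne' (by omega)]
  congr 1

theorem tendsto_tq_of_lt_one (hq : 0 < q) (hq1 : q < 1) :
    Tendsto (fun n => tq q (n + 1) / (tq q n * qInt q (n + 1))) atTop (𝓝 (1 - q)) := by
  have h := (tendsto_tq_succ_div hq hq1).div (tendsto_qInt hq hq1)
    (inv_ne_zero (sub_pos.2 hq1).ne')
  rw [one_div, inv_inv] at h
  exact h.congr fun n => by rw [Pi.div_apply, div_div]

theorem tendsto_tq (hq : 0 < q) :
    Tendsto (fun n => tq q (n + 1) / (tq q n * qInt q (n + 1))) atTop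
      (𝓝 (1 - min q q⁻¹)) := by
  rcases lt_trichotomy q 1 with h | rfl | h
  · rw [min_eq_left (h.le.trans (one_le_inv₀ hq |>.2 h.le))]
    exact tendsto_tq_of_lt_one hq h
  · simpa using tendsto_tq_one
  · have hp := inv_pos.2 hq
    have hp1 := inv_lt_one_of_one_lt₀ h
    rw [min_eq_right (hp1.le.trans h.le)]
    refine (tendsto_tq_of_lt_one hp hp1).congr fun n => ?_
    have := tq_pos hp n
    have := qInt_succ_pos hp n
    rw [tq_eq_pow_mul_tq_inv hq n, tq_eq_pow_mul_tq_inv hq (n + 1), qInt_succ_inv hq,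
      Finset.sum_range_succ, pow_add]
    field_simp

theorem qBinom_mul_tq_pos (hq : 0 < q) {k N : ℕ} (hk : k ≤ N) :
    0 < qBinom q N k * tq q (N - k) := by
  obtain ⟨M, rfl⟩ := Nat.exists_eq_add_of_le hk
  rw [qBinom_add hq, qMulti]
  have := qFact_pos hq (k + M)
  have := qFact_pos hq k
  have := qFact_pos hq M
  have := tq_pos hq (k + M - k)
  positivity

theorem tendsto_qBinom_mul_tq_div_succ (hq : 0 < q) (k : ℕ) :
    Tendsto (fun N => qBinom q N k * tq q (N - k) /
      (qBinom q N (k + 1) * tq q (N - (k + 1)))) atTop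
      (𝓝 ((1 - min q q⁻¹) * qInt q (k + 1))) := by
  rw [← tendsto_add_atTop_iff_nat (k + 1)]
  refine ((tendsto_tq hq).mul_const (qInt q (k + 1))).congr fun M => ?_
  have h1 := qBinom_succ_self_add hq k M
  have h2 := qBinom_mul_tq_pos hq (k := k + 1) (N := k + 1 + M) (by omega)
  have hM := qInt_succ_pos hq M
  have ht := tq_pos hq M
  rw [Nat.add_sub_cancel_left] at h2
  have h3 : 0 < qBinom q (k + 1 + M) (k + 1) := pos_of_mul_pos_left h2 ht.le
  rw [Nat.add_comm M (k + 1), Nat.add_sub_cancel_left, show k + 1 + M - k = M + 1 by omega,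
    div_mul_eq_mul_div, div_eq_div_iff (by positivity) (by positivity)]
  linear_combination (-(tq q (M + 1) * tq q M)) * h1

theorem tendsto_qBinom_mul_tq_div (hq : 0 < q) (j k : ℕ) :
    Tendsto (fun N => qBinom q N k * tq q (N - k) /
      (qBinom q N (j + k) * tq q (N - (j + k)))) atTop
      (𝓝 ((1 - min q q⁻¹) ^ j * (qFact q (j + k) / qFact q k))) := by
  induction j generalizing k with
  | zero =>
    rw [Nat.zero_add, pow_zero, div_self (qFact_pos hq k).ne', one_mul]
    refine tendsto_const_nhds.congr' ?_
    filter_upwards [eventually_ge_atTop k] with N hN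
    rw [div_self (qBinom_mul_tq_pos hq hN).ne']
  | succ j ih =>
    have h := (tendsto_qBinom_mul_tq_div_succ hq k).mul (ih (k + 1))
    rw [show j + (k + 1) = j + 1 + k by ring] at h
    have hk := (qFact_pos hq k).ne'
    have hk' := (qInt_succ_pos hq k).ne'
    convert h.congr' ?_ using 2
    · rw [qFact_succ q k]
      field_simp
      ring
    · filter_upwards [eventually_ge_atTop (k + 1)] with N hN
      rw [div_mul_div_cancel₀ (qBinom_mul_tq_pos hq hN).ne']

theorem qBinom_mul_qFact (hq : 0 < q) (j k : ℕ) :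
    qBinom q (j + k) j * qFact q j = qFact q (j + k) / qFact q k := by
  have hj := (qFact_pos hq j).ne'
  have hk := (qFact_pos hq k).ne'
  rw [qBinom_add hq, qMulti]
  field_simp

theorem tendsto_sum_div {m : ℕ} (hq : 0 < q) {J : Finset ℕ} (hJ : ∀ j ∈ J, j ≤ m) (c : ℕ → ℝ) :
    Tendsto (fun N => (∑ j ∈ J, c j * (qBinom q N (m - j) * tq q (N - (m - j)))) /
      (qBinom q N m * tq q (N - m))) atTop
      (𝓝 (∑ j ∈ J, c j * ((1 - min q q⁻¹) ^ j * (qFact q m / qFact q (m - j))))) := by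
  simp only [Finset.sum_div, mul_div_assoc]
  refine tendsto_finsetSum _ fun j hj => ?_
  have h := tendsto_qBinom_mul_tq_div hq j (m - j)
  rw [Nat.add_sub_cancel' (hJ j hj)] at h
  exact (h.const_mul (c j)).congr fun N => by rw [mul_div_assoc]

end asymptotics

/-- For `σ ∈ S_m` and real `q > 0`, the ratio
`(Σ_{π ∈ I_n(σ)} q^{maj(π^{>m})})/(Σ_{π ∈ I_n} q^{maj(π^{>m})})` tends to
`(Σ_{j ∈ J(σ)} q^{maj(σ^{>j})} [m choose j]_q [j]_q! (1-q̄)^j) /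
 (Σ_{j=0}^m [m]_q! t_j C(m,j) (1-q̄)^j)`. -/
theorem stmt6 {m : ℕ} (σ : Equiv.Perm (Fin m)) (q : ℝ) (hq : 0 < q) :
    Filter.Tendsto (fun n : ℕ =>
        (∑ π ∈ involutionsC n σ, q ^ maj (pTail π m)) /
          (∑ π ∈ involutions n, q ^ maj (pTail π m)))
      Filter.atTop
      (nhds ((∑ j ∈ jSet σ, q ^ maj (pTail σ j) * qBinom q m j * qFact q j *
                (1 - min q q⁻¹) ^ j) /
        (∑ j ∈ Finset.range (m + 1), qFact q m * ((involutions j).card : ℝ) *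
              (m.choose j : ℝ) * (1 - min q q⁻¹) ^ j))) := by
  have hJ : ∀ j ∈ jSet σ, j ≤ m := fun j hj =>
    Nat.lt_succ_iff.1 (Finset.mem_range.1 (Finset.mem_filter.1 hj).1)
  have hR : ∀ j ∈ Finset.range (m + 1), j ≤ m := fun j hj =>
    Nat.lt_succ_iff.1 (Finset.mem_range.1 hj)
  have hnum := tendsto_sum_div hq hJ fun j => q ^ maj (pTail σ j)
  have hden := tendsto_sum_div hq hR fun j =>
    m.choose j * (involutions j).card * qFact q (m - j)
  have hnum' : ∑ j ∈ jSet σ, q ^ maj (pTail σ j) *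
      ((1 - min q q⁻¹) ^ j * (qFact q m / qFact q (m - j))) =
      ∑ j ∈ jSet σ, q ^ maj (pTail σ j) * qBinom q m j * qFact q j * (1 - min q q⁻¹) ^ j := by
    refine Finset.sum_congr rfl fun j hj => ?_
    have h := qBinom_mul_qFact hq j (m - j)
    rw [Nat.add_sub_cancel' (hJ j hj)] at h
    rw [← h]
    ring
  have hden' : ∑ j ∈ Finset.range (m + 1),
      m.choose j * (involutions j).card * qFact q (m - j) *
        ((1 - min q q⁻¹) ^ j * (qFact q m / qFact q (m - j))) =
      ∑ j ∈ Finset.range (m + 1), qFact q m * ((involutions j).card : ℝ) *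
        (m.choose j : ℝ) * (1 - min q q⁻¹) ^ j := by
    refine Finset.sum_congr rfl fun j _ => ?_
    have := (qFact_pos hq (m - j)).ne'
    field_simp
  rw [hnum'] at hnum
  rw [hden'] at hden
  have hmin : 0 ≤ 1 - min q q⁻¹ := by
    rw [sub_nonneg, min_le_iff]
    exact (le_total q 1).imp id inv_le_one_of_one_le₀
  have hpos : 0 < ∑ j ∈ Finset.range (m + 1), qFact q m * ((involutions j).card : ℝ) *
      (m.choose j : ℝ) * (1 - min q q⁻¹) ^ j := by
    have := qFact_pos hq m
    refine Finset.sum_pos' (fun j _ => by positivity) ⟨0, by simp, ?_⟩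
    simpa [involutions, Finset.filter_true_of_mem] using this
  rw [← Filter.tendsto_add_atTop_iff_nat m]
  refine (hnum.div hden hpos.ne').congr' ?_
  filter_upwards [Filter.eventually_ge_atTop m] with N hN
  rw [Pi.div_apply, div_div_div_cancel_right₀ (qBinom_mul_tq_pos hq hN).ne', Nat.add_comm N m,
    sum_involutionsC hq hN, sum_involutions hq hN]

end QT
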